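/- arXiv:math/0206251 — 4 statements merged into one kernel-verified Lean document; each statement's English description precedes it below -/
import Mathlib

section
/- Consider the system with outputs ẋ(t) ∈ F(x(t)), y(t) = h(x(t)), where X = ℝⁿ, F : ℝⁿ → P(ℝⁿ) is locally Lipschitz with nonempty compact values, h : ℝⁿ → ℝᵖ is continuous, and the system is forward complete (every maximal solution is defined on all of [0,∞)). Then the system is output-globally asymptotically stable (oGAS) if and only if it is uniformly output-globally asymptotically stable (oUGAS). -/
open MeasureTheory Set Metric
open scoped ENNReal

/-- `x` is a solution of `ẋ ∈ F(x)` on `[0,T)` (where `T ∈ (0,∞]` and `[0,T)` is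
`{t | 0 ≤ t ∧ ENNReal.ofReal t < T}`): `x` is absolutely continuous on `[0,T)`,
being the indefinite Bochner integral of a locally integrable `v`, with
`v t ∈ F (x t)` for almost every `t ∈ [0,T)`. -/
def IsSolUpTo {n : ℕ} (F : EuclideanSpace ℝ (Fin n) → Set (EuclideanSpace ℝ (Fin n)))
    (x : ℝ → EuclideanSpace ℝ (Fin n)) (T : ℝ≥0∞) : Prop :=
  ∃ v : ℝ → EuclideanSpace ℝ (Fin n),
    (∀ t : ℝ, 0 ≤ t → ENNReal.ofReal t < T → IntegrableOn v (Icc (0:ℝ) t)) ∧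
    (∀ t : ℝ, 0 ≤ t → ENNReal.ofReal t < T → x t = x 0 + ∫ s in (0:ℝ)..t, v s) ∧
    (∀ᵐ t : ℝ, 0 ≤ t → ENNReal.ofReal t < T → v t ∈ F (x t))

/-- `x` is a maximal solution of `ẋ ∈ F(x)`, defined on `[0,T)`: it is a solution on
`[0,T)` which admits no extension to a solution on a strictly larger interval. -/
def IsMaxSol {n : ℕ} (F : EuclideanSpace ℝ (Fin n) → Set (EuclideanSpace ℝ (Fin n)))
    (x : ℝ → EuclideanSpace ℝ (Fin n)) (T : ℝ≥0∞) : Prop :=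
  0 < T ∧ IsSolUpTo F x T ∧
    ¬ ∃ (T' : ℝ≥0∞) (y : ℝ → EuclideanSpace ℝ (Fin n)), T < T' ∧ IsSolUpTo F y T' ∧
        ∀ t : ℝ, 0 ≤ t → ENNReal.ofReal t < T → y t = x t

/-- `S(C)`: the set of maximal solutions of `ẋ ∈ F(x)` with initial value in `C`. -/
def MaxSols {n : ℕ} (F : EuclideanSpace ℝ (Fin n) → Set (EuclideanSpace ℝ (Fin n)))
    (C : Set (EuclideanSpace ℝ (Fin n))) : Set (ℝ → EuclideanSpace ℝ (Fin n)) :=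
  {x | (∃ T : ℝ≥0∞, IsMaxSol F x T) ∧ x 0 ∈ C}

/-- Output-global asymptotic stability (oGAS) of `ẋ ∈ F(x)`, `y = h(x)`:
uniform output stability plus output attraction. -/
def oGAS {n p : ℕ} (F : EuclideanSpace ℝ (Fin n) → Set (EuclideanSpace ℝ (Fin n)))
    (h : EuclideanSpace ℝ (Fin n) → EuclideanSpace ℝ (Fin p)) : Prop :=
  (∀ ε : ℝ, 0 < ε → ∃ δ : ℝ, 0 < δ ∧
    ∀ x ∈ MaxSols F univ, ‖h (x 0)‖ ≤ δ → ∀ t : ℝ, 0 ≤ t → ‖h (x t)‖ ≤ ε) ∧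
  (∀ x ∈ MaxSols F univ,
    Filter.Tendsto (fun t : ℝ => ‖h (x t)‖) Filter.atTop (nhds 0))

/-- Uniform output-global asymptotic stability (oUGAS) of `ẋ ∈ F(x)`, `y = h(x)`:
uniform output stability plus uniform output attraction. -/
def oUGAS {n p : ℕ} (F : EuclideanSpace ℝ (Fin n) → Set (EuclideanSpace ℝ (Fin n)))
    (h : EuclideanSpace ℝ (Fin n) → EuclideanSpace ℝ (Fin p)) : Prop :=
  (∀ ε : ℝ, 0 < ε → ∃ δ : ℝ, 0 < δ ∧
    ∀ x ∈ MaxSols F univ, ‖h (x 0)‖ ≤ δ → ∀ t : ℝ, 0 ≤ t → ‖h (x t)‖ ≤ ε) ∧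
  (∀ κ : ℝ, 0 < κ → ∀ ε : ℝ, 0 < ε → ∃ T : ℝ, 0 < T ∧
    ∀ x ∈ MaxSols F (closedBall (0 : EuclideanSpace ℝ (Fin n)) κ),
      ∀ t : ℝ, T ≤ t → ‖h (x t)‖ ≤ ε)

/-- A measurable map that is `c`-close to a multimap `G` can be moved by at most `c` to become
`c / 2`-close. -/
theorem exists_measurable_refinement {α E : Type*} [MeasurableSpace α] [PseudoMetricSpace E]
    [SecondCountableTopology E] [MeasurableSpace E] [OpensMeasurableSpace E]
    {A : Set α} (hA : MeasurableSet A) {G : α → Set E} (hne : ∀ t, (G t).Nonempty)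
    (hG : ∀ q, Measurable fun t => infDist q (G t)) {v : α → E} (hv : Measurable v)
    {c : α → ℝ} (hc : Measurable c) (hvc : ∀ t ∈ A, infDist (v t) (G t) < c t) :
    ∃ u : α → E, Measurable u ∧
      ∀ t ∈ A, dist (v t) (u t) < c t ∧ infDist (u t) (G t) < c t / 2 := by
  classical
  by_cases hα : IsEmpty α
  · exact ⟨v, hv, fun t => hα.elim t⟩
  obtain ⟨t₀⟩ := not_isEmpty_iff.1 hα
  have : Nonempty E := ⟨v t₀⟩
  let q := TopologicalSpace.denseSeq E
  let P : α → ℕ → Prop := fun t k =>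
    t ∉ A ∨ (dist (v t) (q k) < c t ∧ infDist (q k) (G t) < c t / 2)
  have hP : ∀ t, ∃ k, P t k := by
    intro t
    by_cases ht : t ∈ A
    · obtain ⟨g, hg, hgd⟩ := (infDist_lt_iff (hne t)).1 (hvc t ht)
      have hc0 : 0 < c t := infDist_nonneg.trans_lt (hvc t ht)
      obtain ⟨k, hk⟩ := (TopologicalSpace.denseRange_denseSeq E).exists_dist_lt g
        (lt_min (sub_pos.2 hgd) (half_pos hc0))
      refine ⟨k, Or.inr ⟨?_, ?_⟩⟩
      · have := dist_triangle (v t) g (q k)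
        have := hk.trans_le (min_le_left _ _)
        change dist g (q k) < _ at this
        linarith
      · refine (infDist_le_dist_of_mem hg).trans_lt ?_
        rw [dist_comm]
        exact hk.trans_le (min_le_right _ _)
    · exact ⟨0, Or.inl ht⟩
  refine ⟨fun t => q (Nat.find (hP t)), ?_, ?_⟩
  · refine (measurable_from_nat (f := q)).comp (measurable_find hP fun k => ?_)
    exact hA.compl.union ((measurableSet_lt (hv.dist measurable_const) hc).inter
      (measurableSet_lt (hG _) (hc.div_const 2)))
  · intro t ht
    exact (Nat.find_spec (hP t)).resolve_left (not_not.2 ht)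

/-- Measurable selection: a measurable map `c`-close to a closed-valued multimap `G` is
`2 * c`-close to a measurable selection of `G`. -/
theorem exists_measurable_selection_near {α E : Type*} [MeasurableSpace α] [MetricSpace E]
    [CompleteSpace E] [SecondCountableTopology E] [MeasurableSpace E] [BorelSpace E]
    {A : Set α} (hA : MeasurableSet A) {G : α → Set E} (hne : ∀ t, (G t).Nonempty)
    (hcl : ∀ t, IsClosed (G t))
    (hG : ∀ q, Measurable fun t => infDist q (G t)) {v : α → E} (hv : Measurable v)
    {c : α → ℝ} (hc : Measurable c) (hvc : ∀ t ∈ A, infDist (v t) (G t) < c t) :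
    ∃ u : α → E, Measurable u ∧ (∀ t ∈ A, u t ∈ G t ∧ dist (v t) (u t) ≤ 2 * c t) ∧
      ∀ t ∉ A, u t = v t := by
  classical
  have step : ∀ (k : ℕ) (u : {u : α → E // Measurable u ∧
      ∀ t ∈ A, infDist (u t) (G t) < c t / 2 ^ k}),
      ∃ u' : {u : α → E // Measurable u ∧ ∀ t ∈ A, infDist (u t) (G t) < c t / 2 ^ (k + 1)},
        (∀ t ∈ A, dist (u.1 t) (u'.1 t) ≤ c t / 2 ^ k) ∧ ∀ t ∉ A, u'.1 t = u.1 t := by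
    rintro k ⟨u, hu, huc⟩
    obtain ⟨u', hu', h'⟩ := exists_measurable_refinement hA hne hG hu (hc.div_const (2 ^ k)) huc
    refine ⟨⟨A.piecewise u' u, hu'.piecewise hA hu, fun t ht => ?_⟩, fun t ht => ?_, fun t ht => ?_⟩
    · rw [A.piecewise_eq_of_mem _ _ ht, pow_succ, ← div_div]
      exact (h' t ht).2
    · simpa only [A.piecewise_eq_of_mem _ _ ht] using (h' t ht).1.le
    · simp only [A.piecewise_eq_of_notMem _ _ ht]
  choose next hnext hnext' using step
  let u : (k : ℕ) → {u : α → E // Measurable u ∧ ∀ t ∈ A, infDist (u t) (G t) < c t / 2 ^ k} :=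
    fun k => Nat.rec ⟨v, hv, by simpa using hvc⟩ next k
  have hoff : ∀ k, ∀ t ∉ A, (u k).1 t = v t := by
    intro k t ht
    induction k with
    | zero => rfl
    | succ k ih => exact (hnext' k (u k) t ht).trans ih
  have hdist : ∀ t ∈ A, ∀ k, dist ((u k).1 t) ((u (k + 1)).1 t) ≤ (2 * c t) / 2 / 2 ^ k := by
    intro t ht k
    rw [mul_div_cancel_left₀ _ (two_ne_zero' ℝ)]
    exact hnext k (u k) t ht
  have hlim : ∀ t, ∃ l, Filter.Tendsto (fun k => (u k).1 t) Filter.atTop (nhds l) := by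
    intro t
    by_cases ht : t ∈ A
    · exact cauchySeq_tendsto_of_complete (cauchySeq_of_le_geometric_two (hdist t ht))
    · exact ⟨v t, by simp only [hoff _ t ht]; exact tendsto_const_nhds⟩
  choose w hw using hlim
  refine ⟨w, measurable_of_tendsto_metrizable (fun k => (u k).2.1) (tendsto_pi_nhds.2 hw),
    fun t ht => ⟨?_, ?_⟩, fun t ht => ?_⟩
  · rw [(hcl t).mem_iff_infDist_zero (hne t)]
    have h1 := ((continuous_infDist_pt (G t)).tendsto (w t)).comp (hw t)
    have h2 : Filter.Tendsto (fun k : ℕ => c t / 2 ^ k) Filter.atTop (nhds 0) := by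
      simpa [div_eq_mul_inv] using (tendsto_pow_atTop_nhds_zero_of_lt_one
        (r := (2:ℝ)⁻¹) (by norm_num) (by norm_num)).const_mul (c t)
    exact le_antisymm (le_of_tendsto_of_tendsto' h1 h2 fun k => ((u k).2.2 t ht).le) infDist_nonneg
  · exact dist_le_of_le_geometric_two_of_tendsto₀ (hdist t ht) (hw t)
  · exact tendsto_nhds_unique (hw t) (by simp only [hoff _ t ht]; exact tendsto_const_nhds)

theorem continuous_integral_Ioi {E : Type*} [NormedAddCommGroup E] [NormedSpace ℝ E] {D : ℝ → E}
    (hD : Integrable D) : Continuous fun t => ∫ s in Ioi t, D s := by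
  have h : (fun t => ∫ s in Ioi t, D s) =
      fun t => (∫ s in Ioi (0:ℝ), D s) - ∫ s in (0:ℝ)..t, D s := by
    funext t
    rw [← intervalIntegral.integral_interval_add_Ioi (a := 0) (b := t) hD.integrableOn
      hD.integrableOn]
    abel
  rw [h]
  exact continuous_const.sub
    (intervalIntegral.continuous_primitive (fun _ _ => hD.intervalIntegrable) 0)

/-- Filippov-type existence: an approximate solution with derivative `V` and defect below `g / 2`
can be corrected by an integrable `D` of size `2 * g` to satisfy the inclusion on `A`. -/
theorem exists_selection_of_approximate_solution {E : Type*} [NormedAddCommGroup E]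
    [NormedSpace ℝ E] [CompleteSpace E] [SecondCountableTopology E] [MeasurableSpace E]
    [BorelSpace E] {F : E → Set E} (hne : ∀ ξ, (F ξ).Nonempty) (hcl : ∀ ξ, IsClosed (F ξ))
    (hF : Continuous fun p : E × E => infDist p.1 (F p.2))
    {A : Set ℝ} (hA : MeasurableSet A) {w V : ℝ → E} (hw : Measurable w) (hV : Measurable V)
    {g φ k : ℝ → ℝ} (hg : Measurable g) (hg0 : ∀ t, 0 ≤ g t) (hgi : Integrable g)
    (hφ : ∀ t ∈ A, ∫ s in Ioi t, g s ≤ φ t) (hk0 : ∀ t ∈ A, 0 ≤ k t)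
    (hk : ∀ t ∈ A, k t * φ t ≤ g t / 8)
    (hlip : ∀ t ∈ A, ∀ η ∈ closedBall (w t) (2 * φ t), ∀ ζ ∈ closedBall (w t) (2 * φ t),
      ∀ v ∈ F η, infDist v (F ζ) ≤ k t * dist η ζ)
    (h0 : ∀ t ∈ A, infDist (V t) (F (w t)) < g t / 2) :
    ∃ D : ℝ → E, Integrable D ∧ (∀ t, ‖D t‖ ≤ 2 * g t) ∧
      ∀ t ∈ A, V t + D t ∈ F (w t - ∫ s in Ioi t, D s) := by
  have hint : ∀ {D : ℝ → E} {b : ℝ}, Measurable D → (∀ t, ‖D t‖ ≤ b * g t) → Integrable D :=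
    fun hD hb => (hgi.const_mul _).mono' hD.aestronglyMeasurable (Filter.Eventually.of_forall hb)
  have hbd : ∀ {D : ℝ → E} {b : ℝ}, 0 ≤ b → Measurable D → (∀ t, ‖D t‖ ≤ b * g t) →
      ∀ t ∈ A, ‖∫ s in Ioi t, D s‖ ≤ b * φ t := by
    intro D b hb hD hDb t ht
    calc ‖∫ s in Ioi t, D s‖ ≤ ∫ s in Ioi t, b * g s :=
          norm_integral_le_of_norm_le (hgi.const_mul b).integrableOn
            (Filter.Eventually.of_forall hDb)
      _ = b * ∫ s in Ioi t, g s := integral_const_mul _ _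
      _ ≤ b * φ t := mul_le_mul_of_nonneg_left (hφ t ht) hb
  have step : ∀ (i : ℕ) (D : {D : ℝ → E // Measurable D ∧ (∀ t, ‖D t‖ ≤ (2 - 2 / 2 ^ i) * g t) ∧
      ∀ t ∈ A, infDist (V t + D t) (F (w t - ∫ s in Ioi t, D s)) < g t / 2 / 2 ^ i}),
      ∃ D' : {D : ℝ → E // Measurable D ∧ (∀ t, ‖D t‖ ≤ (2 - 2 / 2 ^ (i + 1)) * g t) ∧
      ∀ t ∈ A, infDist (V t + D t) (F (w t - ∫ s in Ioi t, D s)) < g t / 2 / 2 ^ (i + 1)},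
      ∀ t, ‖D.1 t - D'.1 t‖ ≤ 1 / 2 ^ i * g t := by
    rintro i ⟨D, hD, hDb, hDF⟩
    have hi1 : (1:ℝ) / 2 ^ i ≤ 1 := by
      rw [div_le_one (by positivity)]; exact one_le_pow₀ (by norm_num)
    have hi0 : (0:ℝ) < 1 / 2 ^ i := by positivity
    have e1 : (2:ℝ) / 2 ^ i = 2 * (1 / 2 ^ i) := by ring
    have e2 : (2:ℝ) / 2 ^ (i + 1) = 1 / 2 ^ i := by rw [pow_succ]; field_simp
    have hcont : Continuous fun t => ∫ s in Ioi t, D s := continuous_integral_Ioi (hint hD hDb)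
    have hWm : Measurable fun t => w t - ∫ s in Ioi t, D s := hw.sub hcont.measurable
    have hmeas : ∀ q, Measurable fun t => infDist q (F (w t - ∫ s in Ioi t, D s)) := fun q =>
      have hq : Continuous fun ξ => infDist q (F ξ) := hF.comp (Continuous.prodMk_right q)
      hq.measurable.comp hWm
    obtain ⟨u, hu, huA, huA'⟩ := exists_measurable_selection_near hA
      (G := fun t => F (w t - ∫ s in Ioi t, D s)) (fun t => hne _) (fun t => hcl _) hmeas
      (v := fun t => V t + D t) (hV.add hD) (c := fun t => g t / 2 / 2 ^ i)
      ((hg.div_const 2).div_const (2 ^ i)) hDF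
    have hdiff : ∀ t, ‖D t - (u t - V t)‖ ≤ 1 / 2 ^ i * g t := by
      intro t
      by_cases ht : t ∈ A
      · have h := (huA t ht).2
        rw [dist_eq_norm] at h
        calc ‖D t - (u t - V t)‖ = ‖V t + D t - u t‖ := by
              congr 1; abel
          _ ≤ _ := h
          _ = _ := by ring
      · rw [huA' t ht]
        simpa using mul_nonneg hi0.le (hg0 t)
    have hD'b : ∀ t, ‖u t - V t‖ ≤ (2 - 2 / 2 ^ (i + 1)) * g t := by
      intro t
      have h1 := norm_sub_le (D t) (D t - (u t - V t))
      rw [sub_sub_cancel] at h1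
      have h2 := hdiff t
      have h3 := hDb t
      rw [e2]; rw [e1] at h3
      linarith
    refine ⟨⟨fun t => u t - V t, hu.sub hV, hD'b, fun t ht => ?_⟩, hdiff⟩
    have hb1 := hbd (by rw [e1]; linarith) hD hDb t ht
    have hb2 := hbd (by rw [e2]; linarith) (hu.sub hV) hD'b t ht
    have hb3 := hbd hi0.le (hD.sub (hu.sub hV)) hdiff t ht
    simp only [Pi.sub_apply] at hb2 hb3
    have hD'i : Integrable fun s => u s - V s := hint (hu.sub hV) hD'b
    rw [integral_sub (hint hD hDb).integrableOn hD'i.integrableOn] at hb3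
    change infDist (V t + (u t - V t)) (F (w t - ∫ s in Ioi t, (u s - V s))) < _
    have hφ0 : 0 ≤ φ t := (integral_nonneg hg0).trans (hφ t ht)
    have hgt : 0 < g t := by linarith [h0 t ht, infDist_nonneg (x := V t) (s := F (w t))]
    have hl := hlip t ht (w t - ∫ s in Ioi t, D s)
      (by
        rw [mem_closedBall, dist_eq_norm, sub_sub_cancel_left, norm_neg]
        refine hb1.trans (mul_le_mul_of_nonneg_right ?_ hφ0)
        rw [e1]; linarith)
      (w t - ∫ s in Ioi t, (u s - V s))
      (by
        rw [mem_closedBall, dist_eq_norm, sub_sub_cancel_left, norm_neg]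
        refine hb2.trans (mul_le_mul_of_nonneg_right ?_ hφ0)
        rw [e2]; linarith)
      (u t) (huA t ht).1
    rw [add_sub_cancel]
    refine hl.trans_lt ?_
    rw [dist_eq_norm, sub_sub_sub_cancel_left, norm_sub_rev]
    calc k t * ‖(∫ s in Ioi t, D s) - ∫ s in Ioi t, (u s - V s)‖ ≤ k t * (1 / 2 ^ i * φ t) :=
          mul_le_mul_of_nonneg_left hb3 (hk0 t ht)
      _ = 1 / 2 ^ i * (k t * φ t) := by ring
      _ ≤ 1 / 2 ^ i * (g t / 8) := mul_le_mul_of_nonneg_left (hk t ht) hi0.le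
      _ < 1 / 2 ^ i * (g t / 4) := mul_lt_mul_of_pos_left (by linarith) hi0
      _ = g t / 2 / 2 ^ (i + 1) := by rw [pow_succ]; field_simp; norm_num
  choose next hnext using step
  let D : (i : ℕ) → {D : ℝ → E // Measurable D ∧ (∀ t, ‖D t‖ ≤ (2 - 2 / 2 ^ i) * g t) ∧
      ∀ t ∈ A, infDist (V t + D t) (F (w t - ∫ s in Ioi t, D s)) < g t / 2 / 2 ^ i} :=
    fun i => Nat.rec ⟨fun _ => 0, measurable_const, by simp, by simpa using h0⟩ next i
  have hdist : ∀ t i, dist ((D i).1 t) ((D (i + 1)).1 t) ≤ (2 * g t) / 2 / 2 ^ i := by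
    intro t i
    rw [mul_div_cancel_left₀ _ (two_ne_zero' ℝ), dist_eq_norm]
    exact (hnext i (D i) t).trans_eq (by ring)
  choose D' hD' using fun t =>
    cauchySeq_tendsto_of_complete (cauchySeq_of_le_geometric_two (hdist t))
  have hD'm : Measurable D' :=
    measurable_of_tendsto_metrizable (fun i => (D i).2.1) (tendsto_pi_nhds.2 hD')
  have hDle : ∀ i t, ‖(D i).1 t‖ ≤ 2 * g t := fun i t =>
    ((D i).2.2.1 t).trans (mul_le_mul_of_nonneg_right (by
      have : (0:ℝ) ≤ 2 / 2 ^ i := by positivity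
      linarith) (hg0 t))
  have hD'b : ∀ t, ‖D' t‖ ≤ 2 * g t := fun t =>
    le_of_tendsto' (hD' t).norm fun i => hDle i t
  refine ⟨D', hint hD'm hD'b, hD'b, fun t ht => ?_⟩
  rw [(hcl _).mem_iff_infDist_zero (hne _)]
  have hI : Filter.Tendsto (fun i => ∫ s in Ioi t, (D i).1 s) Filter.atTop
      (nhds (∫ s in Ioi t, D' s)) :=
    tendsto_integral_of_dominated_convergence (fun s => 2 * g s)
      (fun i => (D i).2.1.aestronglyMeasurable) (hgi.const_mul 2).integrableOn
      (fun i => Filter.Eventually.of_forall (hDle i)) (Filter.Eventually.of_forall hD')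
  have h1 := (hF.tendsto (V t + D' t, w t - ∫ s in Ioi t, D' s)).comp
    (((hD' t).const_add (V t)).prodMk_nhds (hI.const_sub (w t)))
  have h2 : Filter.Tendsto (fun i : ℕ => g t / 2 / 2 ^ i) Filter.atTop (nhds 0) := by
    simpa [div_eq_mul_inv] using (tendsto_pow_atTop_nhds_zero_of_lt_one
      (r := (2:ℝ)⁻¹) (by norm_num) (by norm_num)).const_mul (g t / 2)
  exact le_antisymm (le_of_tendsto_of_tendsto' h1 h2 fun i => ((D i).2.2.2 t ht).le) infDist_nonneg

theorem exists_mem_Ico_sum {s : ℕ → ℝ} {t : ℝ} (ht : 0 ≤ t) {m : ℕ}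
    (hm : t < ∑ i ∈ Finset.range m, s i) :
    ∃ j, t ∈ Ico (∑ i ∈ Finset.range j, s i) (∑ i ∈ Finset.range (j + 1), s i) := by
  induction m with
  | zero => simp at hm; linarith
  | succ m ih =>
    by_cases h : t < ∑ i ∈ Finset.range m, s i
    · exact ih h
    · exact ⟨m, not_lt.1 h, hm⟩

theorem exists_measurable_index {a : ℕ → ℝ} (ha : Monotone a) :
    ∃ J : ℝ → ℕ, Measurable J ∧ ∀ j, ∀ t ∈ Ico (a j) (a (j + 1)), J t = j := by
  classical
  let P : ℝ → ℕ → Prop := fun t j => t < a (j + 1) ∨ ¬ ∃ i, t < a (i + 1)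
  have hP : ∀ t, ∃ j, P t j := by
    intro t
    by_cases h : ∃ i, t < a (i + 1)
    · exact h.imp fun _ => Or.inl
    · exact ⟨0, Or.inr h⟩
  refine ⟨fun t => Nat.find (hP t), measurable_find hP fun j => ?_, fun j t ht => ?_⟩
  · refine measurableSet_Iio.union (MeasurableSet.compl ?_)
    exact MeasurableSet.congr (MeasurableSet.iUnion fun i => measurableSet_Iio (a := a (i + 1)))
      (by ext t; exact mem_iUnion)
  · refine (Nat.find_eq_iff _).2 ⟨Or.inl ht.2, fun i hi hPi => ?_⟩
    rcases hPi with h | h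
    · exact absurd (ha (Nat.succ_le_of_lt hi)) (not_le.2 (h.trans_le' ht.1))
    · exact h ⟨j, ht.2⟩

theorem measurable_apply_index {β : Type*} [MeasurableSpace β] {f : ℕ → ℝ → β}
    (hf : ∀ j, Measurable (f j)) {J : ℝ → ℕ} (hJ : Measurable J) :
    Measurable fun t => f (J t) t :=
  Measurable.comp (g := fun p : ℕ × ℝ => f p.1 p.2) (measurable_from_prod_countable_right hf)
    (hJ.prodMk measurable_id)

/-- Arcs `q j` joining `ξ j` to `ξ (j + 1)` in time `s j` concatenate to a single arc. -/
theorem exists_concatenation {E : Type*} [NormedAddCommGroup E] [NormedSpace ℝ E]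
    [MeasurableSpace E] [BorelSpace E]
    {s : ℕ → ℝ} (hs : ∀ j, 0 < s j) {ξ : ℕ → E} {q : ℕ → ℝ → E} (hq : ∀ j, Measurable (q j))
    (hqi : ∀ j, Integrable (q j)) (hξ : ∀ j, ξ (j + 1) = ξ j + ∫ t in (0:ℝ)..s j, q j t) :
    ∃ V w : ℝ → E, Measurable V ∧ Measurable w ∧
      (∀ j, IntegrableOn V (Icc 0 (∑ i ∈ Finset.range j, s i))) ∧
      (∀ j, ∀ t ∈ Ico (∑ i ∈ Finset.range j, s i) (∑ i ∈ Finset.range (j + 1), s i),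
        V t = q j (t - ∑ i ∈ Finset.range j, s i) ∧
        w t = ξ j + ∫ u in (0:ℝ)..(t - ∑ i ∈ Finset.range j, s i), q j u) ∧
      ∀ t, 0 ≤ t → ∀ m, t < ∑ i ∈ Finset.range m, s i → w t = w 0 + ∫ u in (0:ℝ)..t, V u := by
  set a : ℕ → ℝ := fun j => ∑ i ∈ Finset.range j, s i with ha_def
  have ha0 : a 0 = 0 := by simp [ha_def]
  have hasucc : ∀ j, a (j + 1) = a j + s j := fun j => Finset.sum_range_succ s j
  have hlt : ∀ j, a j < a (j + 1) := fun j => by rw [hasucc]; linarith [hs j]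
  have ha : Monotone a := monotone_nat_of_le_succ fun j => (hlt j).le
  obtain ⟨J, hJ, hJa⟩ := exists_measurable_index ha
  let V : ℝ → E := fun t => q (J t) (t - a (J t))
  let w : ℝ → E := fun t => ξ (J t) + ∫ u in (0:ℝ)..(t - a (J t)), q (J t) u
  have hV : ∀ j, ∀ t ∈ Ico (a j) (a (j + 1)), V t = q j (t - a j) := by
    intro j t ht; simp only [V, hJa j t ht]
  have hw : ∀ j, ∀ t ∈ Ico (a j) (a (j + 1)), w t = ξ j + ∫ u in (0:ℝ)..(t - a j), q j u := by
    intro j t ht; simp only [w, hJa j t ht]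
  have hVm : Measurable V := measurable_apply_index (f := fun j t => q j (t - a j))
    (fun j => (hq j).comp (measurable_id.sub_const _)) hJ
  have hwm : Measurable w := by
    refine measurable_apply_index (f := fun j t => ξ j + ∫ u in (0:ℝ)..(t - a j), q j u)
      (fun j => ?_) hJ
    have h := (intervalIntegral.continuous_primitive
      (fun _ _ => (hqi j).intervalIntegrable) 0).comp
        (continuous_id.sub (continuous_const (y := a j)))
    exact (continuous_const.add h).measurable
  have hVpiece : ∀ j, IntegrableOn V (Icc (a j) (a (j + 1))) := by
    intro j
    rw [integrableOn_Icc_iff_integrableOn_Ico]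
    exact ((hqi j).comp_sub_right (a j)).integrableOn.congr_fun
      (fun t ht => (hV j t ht).symm) measurableSet_Ico
  have hVi : ∀ j, IntegrableOn V (Icc 0 (a j)) := by
    intro j
    induction j with
    | zero => simp [ha0]
    | succ j ih =>
      rw [← Icc_union_Icc_eq_Icc (ha0 ▸ ha (Nat.zero_le j)) (hlt j).le]
      exact ih.union (hVpiece j)
  have hpart : ∀ j, ∀ t ∈ Icc (a j) (a (j + 1)),
      ∫ u in (a j)..t, V u = ∫ u in (0:ℝ)..(t - a j), q j u := by
    intro j t ht
    have h := intervalIntegral.integral_comp_sub_right (a := a j) (b := t) (q j) (a j)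
    rw [sub_self] at h
    rw [← h, intervalIntegral.integral_of_le ht.1, intervalIntegral.integral_of_le ht.1,
      ← integral_Ico_eq_integral_Ioc, ← integral_Ico_eq_integral_Ioc]
    exact setIntegral_congr_fun measurableSet_Ico fun u hu => hV j u ⟨hu.1, hu.2.trans_le ht.2⟩
  have hII : ∀ j t, 0 ≤ t → t ≤ a j → IntervalIntegrable V volume 0 t := fun j t h0 h1 =>
    (intervalIntegrable_iff_integrableOn_Icc_of_le h0).2
      ((hVi j).mono_set (Icc_subset_Icc_right h1))
  have hII' : ∀ j, ∀ t ∈ Icc (a j) (a (j + 1)), IntervalIntegrable V volume (a j) t :=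
    fun j t ht => (intervalIntegrable_iff_integrableOn_Icc_of_le ht.1).2
      ((hVpiece j).mono_set (Icc_subset_Icc_right ht.2))
  have hanonneg : ∀ j, 0 ≤ a j := fun j => ha0 ▸ ha (Nat.zero_le j)
  have hξa : ∀ j, ξ 0 + ∫ u in (0:ℝ)..(a j), V u = ξ j := by
    intro j
    induction j with
    | zero => simp [ha0]
    | succ j ih =>
      have hmem : a (j + 1) ∈ Icc (a j) (a (j + 1)) := right_mem_Icc.2 (hlt j).le
      rw [← intervalIntegral.integral_add_adjacent_intervals (hII j _ (hanonneg j) le_rfl)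
        (hII' j _ hmem), ← add_assoc, ih, hpart j _ hmem, hξ, hasucc, add_sub_cancel_left]
  have hw0 : w 0 = ξ 0 := by
    rw [hw 0 0 ⟨ha0.le, by rw [← ha0]; exact hlt 0⟩, ha0]; simp
  refine ⟨V, w, hVm, hwm, hVi, fun j t ht => ⟨hV j t ht, hw j t ht⟩, fun t ht m hm => ?_⟩
  obtain ⟨j, hj⟩ := exists_mem_Ico_sum ht hm
  have hj' : t ∈ Icc (a j) (a (j + 1)) := Ico_subset_Icc_self hj
  rw [hw0, hw j t hj, ← intervalIntegral.integral_add_adjacent_intervals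
    (hII j _ (hanonneg j) le_rfl) (hII' j t hj'), ← add_assoc, hξa, hpart j t hj']

/-- A weight with mass `γ j` on the `j`-th interval, whose tails are controlled by `γ`. -/
theorem exists_step_weight {s γ : ℕ → ℝ} (hs : ∀ j, 0 < s j) (hγ : ∀ j, 0 < γ j)
    (hγ2 : ∀ j, γ (j + 1) ≤ γ j / 2) :
    ∃ g : ℝ → ℝ, Measurable g ∧ (∀ t, 0 ≤ g t) ∧ Integrable g ∧
      ∀ j, ∀ t ∈ Ico (∑ i ∈ Finset.range j, s i) (∑ i ∈ Finset.range (j + 1), s i),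
        g t = γ j / s j ∧ ∫ u in Ioi t, g u ≤ 2 * γ j := by
  set a : ℕ → ℝ := fun j => ∑ i ∈ Finset.range j, s i with ha_def
  have ha0 : a 0 = 0 := by simp [ha_def]
  have hasucc : ∀ j, a (j + 1) = a j + s j := fun j => Finset.sum_range_succ s j
  have ha : Monotone a := monotone_nat_of_le_succ fun j => by rw [hasucc]; linarith [hs j]
  obtain ⟨J, hJ, hJa⟩ := exists_measurable_index ha
  let Ω : Set ℝ := ⋃ j, Ico (a j) (a (j + 1))
  have hΩ : MeasurableSet Ω := MeasurableSet.iUnion fun j => measurableSet_Ico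
  let g : ℝ → ℝ := Ω.indicator fun t => γ (J t) / s (J t)
  have hgm : Measurable g :=
    ((measurable_from_nat (f := fun j => γ j / s j)).comp hJ).indicator hΩ
  have hg0 : ∀ t, 0 ≤ g t := fun t => indicator_nonneg (fun _ _ => (div_pos (hγ _) (hs _)).le) t
  have hgj : ∀ j, ∀ t ∈ Ico (a j) (a (j + 1)), g t = γ j / s j := by
    intro j t ht
    exact (indicator_of_mem (mem_iUnion.2 ⟨j, ht⟩) _).trans (by simp only [hJa j t ht])
  have hγgeo : ∀ j i, γ (j + i) ≤ γ j * (1 / 2) ^ i := by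
    intro j i
    induction i with
    | zero => simp
    | succ i ih =>
      rw [← add_assoc, pow_succ]
      linarith [hγ2 (j + i)]
  have htail : ∀ j, ∫⁻ t in Ici (a j), ‖g t‖ₑ ≤ ENNReal.ofReal (2 * γ j) := by
    intro j
    calc ∫⁻ t in Ici (a j), ‖g t‖ₑ
        ≤ ∫⁻ t in ⋃ i, Ico (a (j + i)) (a (j + i + 1)), ‖g t‖ₑ := by
          rw [← lintegral_indicator measurableSet_Ici,
            ← lintegral_indicator (MeasurableSet.iUnion fun i => measurableSet_Ico)]
          refine lintegral_mono (indicator_le fun t ht => ?_)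
          by_cases hΩt : t ∈ Ω
          · obtain ⟨i, hi⟩ := mem_iUnion.1 hΩt
            have hji : j ≤ i := by
              by_contra hij
              exact absurd (ha (Nat.succ_le_of_lt (not_le.1 hij)))
                (not_le.2 (lt_of_le_of_lt ht hi.2))
            obtain ⟨l, rfl⟩ := Nat.exists_eq_add_of_le hji
            rw [indicator_of_mem (mem_iUnion.2 ⟨l, hi⟩)]
          · simp [g, indicator_of_notMem hΩt]
      _ ≤ ∑' i, ∫⁻ t in Ico (a (j + i)) (a (j + i + 1)), ‖g t‖ₑ := lintegral_iUnion_le _ _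
      _ ≤ ∑' i : ℕ, ENNReal.ofReal (γ j * (1 / 2) ^ i) := by
          refine ENNReal.tsum_le_tsum fun i => ?_
          rw [setLIntegral_congr_fun measurableSet_Ico (g := fun _ => ENNReal.ofReal
            (γ (j + i) / s (j + i))) (fun t ht => by
              simp only [hgj _ t ht]
              exact Real.enorm_of_nonneg (div_pos (hγ _) (hs _)).le)]
          rw [setLIntegral_const, Real.volume_Ico, hasucc, add_sub_cancel_left,
            ← ENNReal.ofReal_mul (div_pos (hγ _) (hs _)).le, div_mul_cancel₀ _ (hs _).ne']
          exact ENNReal.ofReal_le_ofReal (hγgeo j i)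
      _ = ENNReal.ofReal (2 * γ j) := by
          rw [← ENNReal.ofReal_tsum_of_nonneg
            (fun i => mul_nonneg (hγ j).le (by positivity))
            (summable_geometric_two.mul_left _), tsum_mul_left, tsum_geometric_two, mul_comm]
  have hgi : Integrable g := by
    rw [← integrableOn_iff_integrable_of_support_subset (s := Ici (a 0))]
    · exact ⟨hgm.aestronglyMeasurable, (htail 0).trans_lt ENNReal.ofReal_lt_top⟩
    · refine support_indicator_subset.trans (iUnion_subset fun j t ht => ?_)
      exact (ha (Nat.zero_le j)).trans ht.1
  refine ⟨g, hgm, hg0, hgi, fun j t ht => ⟨hgj j t ht, ?_⟩⟩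
  rw [integral_eq_lintegral_of_nonneg_ae (Filter.Eventually.of_forall hg0)
    hgm.aestronglyMeasurable]
  refine ENNReal.toReal_le_of_le_ofReal (by linarith [hγ j]) (le_trans ?_ (htail j))
  simp_rw [← Real.enorm_of_nonneg (hg0 _)]
  exact lintegral_mono_set (fun u hu => ht.1.trans (le_of_lt hu))

/-- On the ball of radius `1 / c` around `ξ`, the map `F` is `c`-Lipschitz and bounded by `c`. -/
def IsLocalBound {E : Type*} [NormedAddCommGroup E] (F : E → Set E) (ξ : E) (c : ℕ) : Prop :=
  1 ≤ c ∧
  (∀ η ∈ closedBall ξ (1 / (c : ℝ)), ∀ ζ ∈ closedBall ξ (1 / (c : ℝ)), ∀ v ∈ F η,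
    infDist v (F ζ) ≤ c * dist η ζ) ∧
  ∀ η ∈ closedBall ξ (1 / (c : ℝ)), ∀ v ∈ F η, ‖v‖ ≤ c

theorem exists_isLocalBound {E : Type*} [NormedAddCommGroup E] {F : E → Set E}
    (hFne : ∀ ξ, (F ξ).Nonempty) (hFcpt : ∀ ξ, IsCompact (F ξ))
    (hFlip : ∀ ξ : E, ∃ U ∈ nhds ξ, ∃ k : ℝ,
      ∀ η ∈ U, ∀ ζ ∈ U, hausdorffDist (F η) (F ζ) ≤ k * ‖η - ζ‖) (ξ : E) :
    ∃ c, IsLocalBound F ξ c := by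
  obtain ⟨U, hU, k, hk⟩ := hFlip ξ
  obtain ⟨r, hr, hrU⟩ := nhds_basis_closedBall.mem_iff.1 hU
  obtain ⟨M, hM⟩ := (hFcpt ξ).isBounded.exists_norm_le
  obtain ⟨c, hc⟩ := exists_nat_ge (max (max 1 (1 / r)) (M + |k| + |k| * r))
  have hc1 : (1:ℝ) ≤ c := (le_max_left _ _).trans ((le_max_left _ _).trans hc)
  have hcr : 1 / r ≤ c := (le_max_right _ _).trans ((le_max_left _ _).trans hc)
  have hcM : M + |k| + |k| * r ≤ c := (le_max_right _ _).trans hc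
  have hM0 : 0 ≤ M := by
    obtain ⟨v, hv⟩ := hFne ξ
    exact (norm_nonneg v).trans (hM v hv)
  have hkr : 0 ≤ |k| * r := by positivity
  have hsub : closedBall ξ (1 / (c : ℝ)) ⊆ closedBall ξ r :=
    closedBall_subset_closedBall (by rw [one_div_le (by linarith) hr]; exact hcr)
  have hinf : ∀ η ∈ closedBall ξ r, ∀ ζ ∈ closedBall ξ r, ∀ v ∈ F η,
      infDist v (F ζ) ≤ |k| * dist η ζ := by
    intro η hη ζ hζ v hv
    have hfin := hausdorffEDist_ne_top_of_nonempty_of_bounded (hFne η) (hFne ζ)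
      (hFcpt η).isBounded (hFcpt ζ).isBounded
    refine (infDist_le_hausdorffDist_of_mem hv hfin).trans ((hk η (hrU hη) ζ (hrU hζ)).trans ?_)
    rw [dist_eq_norm]
    exact mul_le_mul_of_nonneg_right (le_abs_self k) (norm_nonneg _)
  refine ⟨c, by exact_mod_cast hc1, fun η hη ζ hζ v hv => ?_, fun η hη v hv => ?_⟩
  · exact (hinf η (hsub hη) ζ (hsub hζ) v hv).trans
      (mul_le_mul_of_nonneg_right (by linarith) dist_nonneg)
  · obtain ⟨u, hu, huv⟩ := (hFcpt ξ).exists_infDist_eq_dist (hFne ξ) v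
    have h1 := hinf η (hsub hη) ξ (mem_closedBall_self hr.le) v hv
    have h2 : |k| * dist η ξ ≤ |k| * r :=
      mul_le_mul_of_nonneg_left (hsub hη) (abs_nonneg k)
    have h3 := norm_sub_norm_le v u
    rw [huv, dist_eq_norm] at h1
    linarith [hM u hu, abs_nonneg k]

theorem IsLocalBound.of_dist_le {E : Type*} [NormedAddCommGroup E] {F : E → Set E} {ξ ξ' : E}
    {c : ℕ} (h : IsLocalBound F ξ c) (hd : dist ξ' ξ ≤ 1 / (2 * c)) :
    IsLocalBound F ξ' (2 * c) := by
  obtain ⟨h1, h2, h3⟩ := h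
  have hc : (1:ℝ) ≤ c := by exact_mod_cast h1
  have hsub : closedBall ξ' (1 / ((2 * c : ℕ) : ℝ)) ⊆ closedBall ξ (1 / (c : ℝ)) := by
    refine closedBall_subset_closedBall' ?_
    push_cast
    have : 1 / (c : ℝ) = 1 / (2 * c) + 1 / (2 * c) := by field_simp; norm_num
    linarith
  refine ⟨by omega, fun η hη ζ hζ v hv => (h2 η (hsub hη) ζ (hsub hζ) v hv).trans ?_,
    fun η hη v hv => (h3 η (hsub hη) v hv).trans ?_⟩
  · push_cast
    exact mul_le_mul_of_nonneg_right (by linarith) dist_nonneg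
  · push_cast
    linarith

theorem continuous_infDist_of_isLocalBound {E : Type*} [NormedAddCommGroup E] {F : E → Set E}
    (hFne : ∀ ξ, (F ξ).Nonempty) (hFcpt : ∀ ξ, IsCompact (F ξ))
    (hF : ∀ ξ, ∃ c, IsLocalBound F ξ c) :
    Continuous fun p : E × E => infDist p.1 (F p.2) := by
  have key : ∀ p q : E × E, ∀ b : ℝ, (∀ v ∈ F q.2, infDist v (F p.2) ≤ b) →
      infDist p.1 (F p.2) ≤ infDist q.1 (F q.2) + dist p.1 q.1 + b := by
    intro p q b hb
    obtain ⟨v, hv, hqv⟩ := (hFcpt q.2).exists_infDist_eq_dist (hFne q.2) q.1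
    have h1 := infDist_le_infDist_add_dist (s := F p.2) (x := p.1) (y := v)
    linarith [hb v hv, dist_triangle p.1 q.1 v]
  rw [continuous_iff_continuousAt]
  rintro ⟨x, ξ⟩
  obtain ⟨c, hc1, hc2, -⟩ := hF ξ
  have hc0 : (0:ℝ) < 1 / c := one_div_pos.2 (by exact_mod_cast hc1)
  have hξ : ξ ∈ closedBall ξ (1 / (c : ℝ)) := mem_closedBall_self hc0.le
  have hev : ∀ᶠ p : E × E in nhds (x, ξ), dist (infDist p.1 (F p.2)) (infDist x (F ξ)) ≤
      dist p.1 x + c * dist p.2 ξ := by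
    filter_upwards [continuous_snd.continuousAt.preimage_mem_nhds (closedBall_mem_nhds ξ hc0)]
      with p hp
    rw [Real.dist_eq, abs_sub_le_iff]
    have h1 := key p (x, ξ) (c * dist p.2 ξ) fun v hv => by
      rw [dist_comm]; exact hc2 ξ hξ p.2 hp v hv
    have h2 := key (x, ξ) p (c * dist p.2 ξ) fun v hv => hc2 p.2 hp ξ hξ v hv
    simp only [dist_comm x p.1] at h1 h2
    constructor <;> linarith
  have hlim : Filter.Tendsto (fun p : E × E => dist p.1 x + c * dist p.2 ξ) (nhds (x, ξ))
      (nhds 0) := by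
    have : Continuous fun p : E × E => dist p.1 x + c * dist p.2 ξ := by fun_prop
    simpa using this.tendsto (x, ξ)
  exact tendsto_iff_dist_tendsto_zero.2
    (squeeze_zero' (Filter.Eventually.of_forall fun _ => dist_nonneg) hev hlim)

theorem IsSolUpTo.isMaxSol {n : ℕ}
    {F : EuclideanSpace ℝ (Fin n) → Set (EuclideanSpace ℝ (Fin n))}
    {x : ℝ → EuclideanSpace ℝ (Fin n)} (hx : IsSolUpTo F x ⊤) : IsMaxSol F x ⊤ :=
  ⟨ENNReal.zero_lt_top, hx, fun ⟨_, _, hT, _⟩ => not_top_lt hT⟩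

theorem IsSolUpTo.shift {n : ℕ}
    {F : EuclideanSpace ℝ (Fin n) → Set (EuclideanSpace ℝ (Fin n))}
    {x : ℝ → EuclideanSpace ℝ (Fin n)} (hx : IsSolUpTo F x ⊤) {s : ℝ} (hs : 0 ≤ s) :
    IsSolUpTo F (fun t => x (s + t)) ⊤ := by
  obtain ⟨v, hvi, hxv, hvF⟩ := hx
  have hI : ∀ t, 0 ≤ t → IntervalIntegrable v volume 0 t := fun t ht =>
    (intervalIntegrable_iff_integrableOn_Icc_of_le ht).2 (hvi t ht ENNReal.ofReal_lt_top)
  have hI' : ∀ t, 0 ≤ t → IntervalIntegrable v volume s (s + t) := fun t ht =>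
    (hI s hs).symm.trans (hI (s + t) (by linarith))
  refine ⟨fun t => v (s + t), fun t ht _ => ?_, fun t ht _ => ?_, ?_⟩
  · have h := (hI' t ht).comp_add_left s
    rw [sub_self, add_sub_cancel_left] at h
    exact (intervalIntegrable_iff_integrableOn_Icc_of_le ht).1 h
  · change x (s + t) = x (s + 0) + ∫ u in (0:ℝ)..t, v (s + u)
    rw [hxv (s + t) (by linarith) ENNReal.ofReal_lt_top, add_zero,
      hxv s hs ENNReal.ofReal_lt_top, intervalIntegral.integral_comp_add_left, add_zero, add_assoc,
      intervalIntegral.integral_add_adjacent_intervals (hI s hs) (hI' t ht)]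
  · filter_upwards [(measurePreserving_add_left volume s).quasiMeasurePreserving.ae hvF]
      with t ht h0 _
    exact ht (by linarith) ENNReal.ofReal_lt_top

theorem IsSolUpTo.continuousOn {n : ℕ}
    {F : EuclideanSpace ℝ (Fin n) → Set (EuclideanSpace ℝ (Fin n))}
    {x : ℝ → EuclideanSpace ℝ (Fin n)} {T : ℝ≥0∞} (hx : IsSolUpTo F x T) {t : ℝ} (ht : 0 ≤ t)
    (htT : ENNReal.ofReal t < T) : ContinuousOn x (Icc 0 t) := by
  obtain ⟨v, hvi, hxv, -⟩ := hx
  have h := intervalIntegral.continuousOn_primitive_interval (a := 0) (b := t) (f := v)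
    (μ := volume) (by rw [uIcc_of_le ht]; exact hvi t ht htT)
  rw [uIcc_of_le ht] at h
  exact (continuousOn_const.add h).congr fun u hu =>
    hxv u hu.1 ((ENNReal.ofReal_le_ofReal hu.2).trans_lt htT)

theorem IsSolUpTo.dist_lt_of_bound {n : ℕ}
    {F : EuclideanSpace ℝ (Fin n) → Set (EuclideanSpace ℝ (Fin n))}
    {x : ℝ → EuclideanSpace ℝ (Fin n)} (hx : IsSolUpTo F x ⊤) {ξ : EuclideanSpace ℝ (Fin n)}
    {r c s : ℝ} (hc : 0 ≤ c) (hb : ∀ η ∈ closedBall ξ r, ∀ v ∈ F η, ‖v‖ ≤ c)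
    (h0 : dist (x 0) ξ + c * s < r) {t : ℝ} (ht : t ∈ Icc 0 s) : dist (x t) ξ < r := by
  by_contra! hcon
  have hs : 0 ≤ s := ht.1.trans ht.2
  have hcont : ContinuousOn (fun t => dist (x t) ξ) (Icc 0 s) :=
    (continuous_id.dist continuous_const).comp_continuousOn
      (hx.continuousOn hs ENNReal.ofReal_lt_top)
  have hcpt : IsCompact (Icc 0 s ∩ (fun t => dist (x t) ξ) ⁻¹' Ici r) :=
    isCompact_Icc.of_isClosed_subset
      (hcont.preimage_isClosed_of_isClosed isClosed_Icc isClosed_Ici) inter_subset_left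
  obtain ⟨τ, ⟨hτ, hτr⟩, hleast⟩ := hcpt.exists_isLeast ⟨t, ht, hcon⟩
  obtain ⟨v, hvi, hxv, hvF⟩ := hx
  have hbefore : ∀ u, 0 ≤ u → u < τ → dist (x u) ξ ≤ r := by
    intro u hu huτ
    by_contra! hur
    exact absurd (hleast ⟨⟨hu, huτ.le.trans hτ.2⟩, hur.le⟩) (not_le.2 huτ)
  have hn : ‖∫ u in (0:ℝ)..τ, v u‖ ≤ c * |τ - 0| := by
    refine intervalIntegral.norm_integral_le_of_norm_le_const_ae ?_
    filter_upwards [hvF, Measure.ae_ne volume τ] with u hu huτ hmem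
    rw [uIoc_of_le hτ.1] at hmem
    exact hb _ (hbefore u hmem.1.le (lt_of_le_of_ne hmem.2 huτ)) _
      (hu hmem.1.le ENNReal.ofReal_lt_top)
  rw [sub_zero, abs_of_nonneg hτ.1] at hn
  have h1 : dist (x τ) (x 0) ≤ c * s := by
    rw [dist_eq_norm, hxv τ hτ.1 ENNReal.ofReal_lt_top, add_sub_cancel_left]
    exact hn.trans (mul_le_mul_of_nonneg_left hτ.2 hc)
  have h2 := dist_triangle (x τ) (x 0) ξ
  have h3 : r ≤ dist (x τ) ξ := hτr
  linarith

/-- Arbitrarily close to `ξ` start solutions whose output stays above `δ` for arbitrarily long. -/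
def IsOutputPersistent {n p : ℕ}
    (F : EuclideanSpace ℝ (Fin n) → Set (EuclideanSpace ℝ (Fin n)))
    (h : EuclideanSpace ℝ (Fin n) → EuclideanSpace ℝ (Fin p)) (δ : ℝ)
    (ξ : EuclideanSpace ℝ (Fin n)) : Prop :=
  ∀ ε : ℝ, 0 < ε → ∀ N : ℝ, ∃ x, IsSolUpTo F x ⊤ ∧ dist (x 0) ξ < ε ∧
    ∀ t ∈ Icc 0 N, δ ≤ ‖h (x t)‖

theorem exists_isOutputPersistent_of_isCompact {n p : ℕ}
    {F : EuclideanSpace ℝ (Fin n) → Set (EuclideanSpace ℝ (Fin n))}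
    {h : EuclideanSpace ℝ (Fin n) → EuclideanSpace ℝ (Fin p)} {δ : ℝ}
    {K : Set (EuclideanSpace ℝ (Fin n))} (hK : IsCompact K)
    {x : ℕ → ℝ → EuclideanSpace ℝ (Fin n)} (hx : ∀ k, IsSolUpTo F (x k) ⊤)
    (hxK : ∀ k, x k 0 ∈ K) (hxh : ∀ k : ℕ, ∀ t ∈ Icc (0:ℝ) k, δ ≤ ‖h (x k t)‖) :
    ∃ ξ, IsOutputPersistent F h δ ξ ∧
      ∀ ε : ℝ, 0 < ε → ∃ᶠ k in Filter.atTop, dist (x k 0) ξ < ε := by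
  obtain ⟨ξ, -, hξ⟩ := hK.exists_mapClusterPt (f := Filter.atTop) (u := fun k => x k 0)
    (Filter.tendsto_principal.2 (Filter.Eventually.of_forall hxK))
  have hfreq : ∀ ε : ℝ, 0 < ε → ∃ᶠ k in Filter.atTop, dist (x k 0) ξ < ε := fun ε hε =>
    hξ.frequently (ball_mem_nhds ξ hε)
  refine ⟨ξ, fun ε hε N => ?_, hfreq⟩
  obtain ⟨k, hk, hkN⟩ := ((hfreq ε hε).and_eventually
    (tendsto_natCast_atTop_atTop.eventually_ge_atTop N)).exists
  exact ⟨x k, hx k, hk, fun t ht => hxh k t ⟨ht.1, ht.2.trans hkN⟩⟩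

/-- Flowing for a short time `s`, an output-persistent point leads to another one. -/
theorem IsOutputPersistent.exists_next {n p : ℕ}
    {F : EuclideanSpace ℝ (Fin n) → Set (EuclideanSpace ℝ (Fin n))}
    {h : EuclideanSpace ℝ (Fin n) → EuclideanSpace ℝ (Fin p)} {δ : ℝ}
    {ξ : EuclideanSpace ℝ (Fin n)} (hξ : IsOutputPersistent F h δ ξ) {c : ℕ}
    (hc : IsLocalBound F ξ c) {s : ℝ} (hs0 : 0 ≤ s) (hs : c * s ≤ 1 / (16 * c)) :
    ∃ ξ', IsOutputPersistent F h δ ξ' ∧ ∀ ε : ℝ, 0 < ε → ∃ x, IsSolUpTo F x ⊤ ∧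
      dist (x 0) ξ < ε ∧ dist (x s) ξ' < ε ∧ ∀ t ∈ Icc 0 s, δ ≤ ‖h (x t)‖ := by
  have hc1 : (1:ℝ) ≤ c := by exact_mod_cast hc.1
  have e1 : 1 / (16 * (c:ℝ)) = 1 / c / 16 := by field_simp
  have hpos : 0 < 1 / (c:ℝ) := by positivity
  choose x hx hx0 hxh using fun k : ℕ =>
    hξ (min (1 / ((k:ℝ) + 1)) (1 / (c:ℝ) / 4)) (lt_min (by positivity) (by positivity)) (s + k)
  have hxs : ∀ k, x k s ∈ closedBall ξ (1 / (c:ℝ)) := fun k =>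
    ((hx k).dist_lt_of_bound (Nat.cast_nonneg c) hc.2.2
      (by linarith [(hx0 k).trans_le (min_le_right _ _)]) (right_mem_Icc.2 hs0)).le
  obtain ⟨ξ', hξ', hfreq⟩ := exists_isOutputPersistent_of_isCompact (F := F) (h := h) (δ := δ)
    (isCompact_closedBall ξ (1 / (c:ℝ))) (x := fun k t => x k (s + t))
    (fun k => (hx k).shift hs0) (fun k => by simpa using hxs k)
    (fun k t ht => hxh k (s + t) ⟨by linarith [ht.1], by linarith [ht.2]⟩)
  refine ⟨ξ', hξ', fun ε hε => ?_⟩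
  obtain ⟨k, hk, hkε⟩ := ((hfreq ε hε).and_eventually
    (tendsto_one_div_add_atTop_nhds_zero_nat.eventually_lt_const hε)).exists
  exact ⟨x k, hx k, ((hx0 k).trans_le (min_le_left _ _)).trans hkε, by simpa using hk,
    fun t ht => hxh k t ⟨ht.1, ht.2.trans (by linarith [Nat.cast_nonneg (α := ℝ) k])⟩⟩

/-- Limits of solution segments yield arcs with exact endpoints and arbitrarily small defect. -/
theorem exists_approximate_arc {n p : ℕ}
    {F : EuclideanSpace ℝ (Fin n) → Set (EuclideanSpace ℝ (Fin n))}
    {h : EuclideanSpace ℝ (Fin n) → EuclideanSpace ℝ (Fin p)} {δ : ℝ}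
    {ξ ξ' : EuclideanSpace ℝ (Fin n)} {c : ℕ}
    (hc : IsLocalBound F ξ c) {s : ℝ} (hs0 : 0 < s) (hs : c * s ≤ 1 / (16 * c))
    (hx : ∀ ε : ℝ, 0 < ε → ∃ x, IsSolUpTo F x ⊤ ∧
      dist (x 0) ξ < ε ∧ dist (x s) ξ' < ε ∧ ∀ t ∈ Icc 0 s, δ ≤ ‖h (x t)‖)
    {ρ : ℝ} (hρ : 0 < ρ) :
    ∃ q : ℝ → EuclideanSpace ℝ (Fin n), Measurable q ∧ Integrable q ∧
      ξ' = ξ + ∫ t in (0:ℝ)..s, q t ∧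
      (∀ t ∈ Icc 0 s, ∃ η, dist η ξ ≤ 1 / c / 2 ∧ δ ≤ ‖h η‖ ∧
        dist (ξ + ∫ u in (0:ℝ)..t, q u) η ≤ min ρ (1 / c / 4)) ∧
      ∀ᵐ t : ℝ, t ∈ Icc 0 s → infDist (q t) (F (ξ + ∫ u in (0:ℝ)..t, q u)) < ρ := by
  have hc1 : (1:ℝ) ≤ c := by exact_mod_cast hc.1
  have e1 : 1 / (16 * (c:ℝ)) = 1 / c / 16 := by field_simp
  have hpos : 0 < 1 / (c:ℝ) := by positivity
  obtain ⟨ε, hε0, hερ, hεc, hεs⟩ : ∃ ε : ℝ, 0 < ε ∧ ε ≤ ρ ∧ ε ≤ 1 / c / 4 ∧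
      2 * ε / s + c * ε < ρ := by
    have hk : 0 < 2 / s + c + 1 := by positivity
    refine ⟨min (ρ / (2 / s + c + 1)) (1 / c / 4), lt_min (by positivity) (by positivity), ?_,
      min_le_right _ _, ?_⟩
    · refine (min_le_left _ _).trans (div_le_self hρ.le ?_)
      have : 0 < 2 / s := by positivity
      linarith
    · have h1 := min_le_left (ρ / (2 / s + c + 1)) (1 / (c:ℝ) / 4)
      have h2 : 0 < min (ρ / (2 / s + c + 1)) (1 / (c:ℝ) / 4) :=
        lt_min (by positivity) (by positivity)
      rw [le_div_iff₀ hk] at h1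
      have h3 : 2 * min (ρ / (2 / s + c + 1)) (1 / (c:ℝ) / 4) / s =
        min (ρ / (2 / s + c + 1)) (1 / (c:ℝ) / 4) * (2 / s) := by ring
      rw [h3]
      linarith
  obtain ⟨x, hsol, hx0, hxs, hxh⟩ := hx ε hε0
  have hball : ∀ t ∈ Icc 0 s, dist (x t) ξ < 1 / c / 2 := fun t ht =>
    hsol.dist_lt_of_bound (Nat.cast_nonneg c)
      (fun η hη => hc.2.2 η (closedBall_subset_closedBall (by linarith) hη)) (by linarith) ht
  obtain ⟨v, hvi, hxv, hvF⟩ := hsol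
  have hvs := hvi s hs0.le ENNReal.ofReal_lt_top
  have hvm := hvs.aestronglyMeasurable
  have hvI : ∀ t ∈ Icc 0 s, IntervalIntegrable v volume 0 t := fun t ht =>
    (intervalIntegrable_iff_integrableOn_Icc_of_le ht.1).2
      (hvs.mono_set (Icc_subset_Icc_right ht.2))
  set e := (1 / s) • ((ξ' - x s) - (ξ - x 0)) with he
  let q : ℝ → EuclideanSpace ℝ (Fin n) := (Icc 0 s).indicator fun t => hvm.mk v t + e
  have hqm : Measurable q :=
    (hvm.stronglyMeasurable_mk.measurable.add_const e).indicator measurableSet_Icc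
  have hmk : ∀ᵐ t : ℝ, t ∈ Icc 0 s → q t = v t + e := by
    filter_upwards [(ae_restrict_iff' measurableSet_Icc).1 hvm.ae_eq_mk] with t ht hts
    simp only [q, indicator_of_mem hts, ht hts]
  have hqi : Integrable q := by
    rw [integrable_indicator_iff measurableSet_Icc]
    exact (hvs.congr hvm.ae_eq_mk).add (integrableOn_const (by simp))
  have hint : ∀ t ∈ Icc 0 s, ∫ u in (0:ℝ)..t, q u = (x t - x 0) + t • e := by
    intro t ht
    have h1 : ∫ u in (0:ℝ)..t, q u = ∫ u in (0:ℝ)..t, (v u + e) := by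
      refine intervalIntegral.integral_congr_ae ?_
      filter_upwards [hmk] with u hu hut
      rw [uIoc_of_le ht.1] at hut
      exact hu ⟨hut.1.le, hut.2.trans ht.2⟩
    rw [h1, intervalIntegral.integral_add (hvI t ht) intervalIntegrable_const,
      intervalIntegral.integral_const, sub_zero, hxv t ht.1 ENNReal.ofReal_lt_top,
      add_sub_cancel_left]
  have hp : ∀ t ∈ Icc 0 s, dist (ξ + ∫ u in (0:ℝ)..t, q u) (x t) ≤ ε := by
    intro t ht
    have hts : t / s ≤ 1 := (div_le_one hs0).2 ht.2
    have hts0 : 0 ≤ t / s := div_nonneg ht.1 hs0.le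
    have heq : ξ + ((x t - x 0) + t • e) - x t =
        (1 - t / s) • (ξ - x 0) + (t / s) • (ξ' - x s) := by
      rw [he, smul_smul, mul_one_div, sub_smul, one_smul, smul_sub]
      abel
    rw [dist_eq_norm, hint t ht, heq]
    rw [dist_eq_norm, norm_sub_rev] at hx0 hxs
    calc _ ≤ ‖(1 - t / s) • (ξ - x 0)‖ + ‖(t / s) • (ξ' - x s)‖ := norm_add_le _ _
      _ = (1 - t / s) * ‖ξ - x 0‖ + (t / s) * ‖ξ' - x s‖ := by
        rw [norm_smul, norm_smul, Real.norm_of_nonneg hts0, Real.norm_of_nonneg (by linarith)]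
      _ ≤ (1 - t / s) * ε + (t / s) * ε :=
        add_le_add (mul_le_mul_of_nonneg_left hx0.le (by linarith))
          (mul_le_mul_of_nonneg_left hxs.le hts0)
      _ = ε := by ring
  have hen : ‖e‖ ≤ 2 * ε / s := by
    rw [dist_eq_norm, norm_sub_rev] at hx0 hxs
    rw [he, norm_smul, Real.norm_of_nonneg (by positivity), one_div_mul_eq_div]
    exact div_le_div_of_nonneg_right ((norm_sub_le _ _).trans (by linarith)) hs0.le
  refine ⟨q, hqm, hqi, ?_, fun t ht => ⟨x t, (hball t ht).le, hxh t ht,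
    (hp t ht).trans (le_min hερ hεc)⟩, ?_⟩
  · rw [hint s (right_mem_Icc.2 hs0.le), he, smul_smul, mul_one_div_cancel hs0.ne', one_smul]
    abel
  · filter_upwards [hmk, hvF] with t htq htv ht
    have hvt := htv ht.1 ENNReal.ofReal_lt_top
    have hpt := hp t ht
    have hd : dist (q t) (v t) = ‖e‖ := by
      rw [htq ht, dist_eq_norm, add_sub_cancel_left]
    have h1 := infDist_le_infDist_add_dist (s := F (ξ + ∫ u in (0:ℝ)..t, q u)) (x := q t) (y := v t)
    have h2 := hc.2.1 (x t) (by rw [mem_closedBall]; linarith [hball t ht])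
      (ξ + ∫ u in (0:ℝ)..t, q u)
      (by
        rw [mem_closedBall]
        linarith [hball t ht, dist_triangle (ξ + ∫ u in (0:ℝ)..t, q u) (x t) ξ])
      (v t) hvt
    rw [dist_comm] at h2
    have h3 : (c:ℝ) * dist (ξ + ∫ u in (0:ℝ)..t, q u) (x t) ≤ c * ε :=
      mul_le_mul_of_nonneg_left hpt (by linarith)
    linarith

theorem exists_halving_sequence_le {β : ℕ → ℝ} (hβ : ∀ j, 0 < β j) :
    ∃ γ : ℕ → ℝ, (∀ j, 0 < γ j) ∧ (∀ j, γ (j + 1) ≤ γ j / 2) ∧ ∀ j, γ j ≤ β j := by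
  let γ : ℕ → ℝ := fun j => Nat.rec (β 0) (fun j r => min (β (j + 1)) (r / 2)) j
  refine ⟨γ, fun j => ?_, fun j => min_le_right _ _, fun j => ?_⟩
  · induction j with
    | zero => exact hβ 0
    | succ j ih => exact lt_min (hβ _) (half_pos ih)
  · cases j with
    | zero => exact le_rfl
    | succ j => exact min_le_left _ _

theorem ae_comp_sub_right {P : ℝ → Prop} (hP : ∀ᵐ t, P t) (a : ℝ) : ∀ᵐ t, P (t - a) :=
  (measurePreserving_sub_right volume a).quasiMeasurePreserving.ae hP

theorem measurable_infDist_comp {α E : Type*} [MeasurableSpace α] [PseudoMetricSpace E]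
    [SecondCountableTopology E] [MeasurableSpace E] [OpensMeasurableSpace E] {F : E → Set E}
    (hF : Continuous fun p : E × E => infDist p.1 (F p.2)) {V w : α → E} (hV : Measurable V)
    (hw : Measurable w) : Measurable fun t => infDist (V t) (F (w t)) := by
  have h := hF.measurable.comp (hV.prodMk hw)
  exact h

/-- Concatenated approximate arcs whose defects decay geometrically, relative to the local bounds
of `F`, are shadowed by a solution. -/
theorem exists_isSolUpTo_near_concatenation {n : ℕ}
    {F : EuclideanSpace ℝ (Fin n) → Set (EuclideanSpace ℝ (Fin n))}
    (hFne : ∀ ξ, (F ξ).Nonempty) (hFcpt : ∀ ξ, IsCompact (F ξ))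
    (hF : ∀ ξ, ∃ c, IsLocalBound F ξ c)
    {s γ : ℕ → ℝ} {c : ℕ → ℕ} {ξ : ℕ → EuclideanSpace ℝ (Fin n)}
    {q : ℕ → ℝ → EuclideanSpace ℝ (Fin n)} (hc : ∀ j, IsLocalBound F (ξ j) (c j))
    (hs : ∀ j, 0 < s j) (hsc : ∀ j, 16 * c j * s j ≤ 1)
    (hγ : ∀ j, 0 < γ j) (hγ2 : ∀ j, γ (j + 1) ≤ γ j / 2) (hγc : ∀ j, 4 * γ j ≤ 1 / c j / 4)
    (hq : ∀ j, Measurable (q j)) (hqi : ∀ j, Integrable (q j))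
    (hξ : ∀ j, ξ (j + 1) = ξ j + ∫ t in (0:ℝ)..s j, q j t)
    (hdist : ∀ j, ∀ t ∈ Icc 0 (s j),
      dist (ξ j + ∫ u in (0:ℝ)..t, q j u) (ξ j) ≤ 3 / 4 * (1 / c j))
    (hae : ∀ j, ∀ᵐ t : ℝ, t ∈ Icc 0 (s j) →
      infDist (q j t) (F (ξ j + ∫ u in (0:ℝ)..t, q j u)) < γ j / s j / 2) :
    ∃ z, IsSolUpTo F z (⨆ m, ENNReal.ofReal (∑ i ∈ Finset.range m, s i)) ∧
      ∀ j, ∀ t ∈ Ico (∑ i ∈ Finset.range j, s i) (∑ i ∈ Finset.range (j + 1), s i),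
        dist (z t) (ξ j + ∫ u in (0:ℝ)..(t - ∑ i ∈ Finset.range j, s i), q j u) ≤ 4 * γ j := by
  obtain ⟨V, w, hV, hw, hVi, hVw, hwV⟩ := exists_concatenation hs hq hqi hξ
  obtain ⟨g, hg, hg0, hgi, hgj⟩ := exists_step_weight hs hγ hγ2
  set a : ℕ → ℝ := fun j => ∑ i ∈ Finset.range j, s i with ha_def
  have hasucc : ∀ j, a (j + 1) = a j + s j := fun j => Finset.sum_range_succ s j
  have ha : Monotone a := monotone_nat_of_le_succ fun j => by rw [hasucc]; linarith [hs j]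
  obtain ⟨J, -, hJa⟩ := exists_measurable_index ha
  have hcont := continuous_infDist_of_isLocalBound hFne hFcpt hF
  have hmem : ∀ j, ∀ t ∈ Ico (a j) (a (j + 1)), t - a j ∈ Icc 0 (s j) := fun j t ht =>
    ⟨sub_nonneg.2 ht.1, by linarith [ht.2, hasucc j]⟩
  let A : Set ℝ := (⋃ j, Ico (a j) (a (j + 1))) ∩ {t | infDist (V t) (F (w t)) < g t / 2}
  have hdef : Measurable fun t => infDist (V t) (F (w t)) :=
    measurable_infDist_comp hcont hV hw
  have hA : MeasurableSet A := (MeasurableSet.iUnion fun j => measurableSet_Ico).inter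
    (measurableSet_lt hdef (hg.div_const 2))
  have hAJ : ∀ t ∈ A, t ∈ Ico (a (J t)) (a (J t + 1)) := by
    intro t ht
    obtain ⟨j, hj⟩ := mem_iUnion.1 ht.1
    rwa [hJa j t hj]
  have hAae : ∀ᵐ t : ℝ, ∀ j, t ∈ Ico (a j) (a (j + 1)) → t ∈ A := by
    rw [ae_all_iff]
    intro j
    filter_upwards [ae_comp_sub_right (hae j) (a j)] with t ht htj
    refine ⟨mem_iUnion.2 ⟨j, htj⟩, ?_⟩
    have h := ht (hmem j t htj)
    rw [← (hVw j t htj).1, ← (hVw j t htj).2, ← (hgj j t htj).1] at h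
    exact h
  have hcpos : ∀ j, (0:ℝ) < c j := fun j => by exact_mod_cast (hc j).1
  obtain ⟨D, hDi, hDb, hDF⟩ := exists_selection_of_approximate_solution hFne
    (fun ξ => (hFcpt ξ).isClosed) hcont hA hw hV hg hg0 hgi
    (φ := fun t => 2 * γ (J t)) (k := fun t => c (J t))
    (fun t ht => (hgj _ t (hAJ t ht)).2) (fun t _ => Nat.cast_nonneg _)
    (by
      intro t ht
      rw [(hgj _ t (hAJ t ht)).1, div_div, le_div_iff₀ (by linarith [hs (J t)])]
      have := mul_le_mul_of_nonneg_left (hsc (J t)) (hγ (J t)).le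
      linarith)
    (by
      intro t ht η hη ζ hζ v hv
      have hwt : dist (w t) (ξ (J t)) ≤ 3 / 4 * (1 / c (J t)) := by
        rw [(hVw _ t (hAJ t ht)).2]
        exact hdist _ _ (hmem _ t (hAJ t ht))
      have hsub : closedBall (w t) (2 * (2 * γ (J t))) ⊆ closedBall (ξ (J t)) (1 / c (J t)) :=
        closedBall_subset_closedBall' (by linarith [hγc (J t)])
      exact (hc (J t)).2.1 η (hsub hη) ζ (hsub hζ) v hv)
    (fun t ht => ht.2)
  have hlt : ∀ t, ENNReal.ofReal t < (⨆ m, ENNReal.ofReal (a m)) → ∃ m, t < a m := by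
    intro t ht
    obtain ⟨m, hm⟩ := lt_iSup_iff.1 ht
    exact ⟨m, lt_of_not_ge fun hle => absurd (ENNReal.ofReal_le_ofReal hle) (not_le.2 hm)⟩
  obtain ⟨z, hz⟩ : ∃ z : ℝ → EuclideanSpace ℝ (Fin n), ∀ t, z t = w t - ∫ u in Ioi t, D u :=
    ⟨_, fun _ => rfl⟩
  refine ⟨z, ⟨fun t => V t + D t, fun t _ htT => ?_, fun t ht htT => ?_, ?_⟩, fun j t ht => ?_⟩
  · obtain ⟨m, hm⟩ := hlt t htT
    exact ((hVi m).mono_set (Icc_subset_Icc_right hm.le)).add hDi.integrableOn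
  · obtain ⟨m, hm⟩ := hlt t htT
    have hVt : IntervalIntegrable V volume 0 t :=
      (intervalIntegrable_iff_integrableOn_Icc_of_le ht).2
        ((hVi m).mono_set (Icc_subset_Icc_right hm.le))
    rw [hz t, hz 0, intervalIntegral.integral_add hVt hDi.intervalIntegrable, hwV t ht m hm,
      ← intervalIntegral.integral_interval_add_Ioi (a := 0) (b := t) hDi.integrableOn
        hDi.integrableOn]
    abel
  · filter_upwards [hAae] with t htA ht htT
    obtain ⟨m, hm⟩ := hlt t htT
    obtain ⟨j, hj⟩ := exists_mem_Ico_sum ht hm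
    rw [hz t]
    exact hDF t (htA j hj)
  · rw [← (hVw j t ht).2, dist_eq_norm, hz t, sub_right_comm, sub_self, zero_sub, norm_neg]
    calc ‖∫ u in Ioi t, D u‖ ≤ ∫ u in Ioi t, 2 * g u :=
          norm_integral_le_of_norm_le (hgi.const_mul 2).integrableOn
            (Filter.Eventually.of_forall hDb)
      _ = 2 * ∫ u in Ioi t, g u := integral_const_mul _ _
      _ ≤ 4 * γ j := by linarith [(hgj j t ht).2]

/-- An output-persistent point gives rise to a solution whose output stays above `δ / 2`, built over
successive intervals whose lengths are dictated by the local bounds of `F`. -/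
theorem IsOutputPersistent.exists_isSolUpTo {n p : ℕ}
    {F : EuclideanSpace ℝ (Fin n) → Set (EuclideanSpace ℝ (Fin n))}
    (hFne : ∀ ξ, (F ξ).Nonempty) (hFcpt : ∀ ξ, IsCompact (F ξ))
    {h : EuclideanSpace ℝ (Fin n) → EuclideanSpace ℝ (Fin p)} (hh : Continuous h)
    {c : EuclideanSpace ℝ (Fin n) → ℕ} (hc : ∀ ξ, IsLocalBound F ξ (c ξ))
    {δ : ℝ} (hδ : 0 < δ) {ξ₀ : EuclideanSpace ℝ (Fin n)} (hξ₀ : IsOutputPersistent F h δ ξ₀) :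
    ∃ (s : ℕ → ℝ) (ξ : ℕ → EuclideanSpace ℝ (Fin n)) (z : ℝ → EuclideanSpace ℝ (Fin n)),
      (∀ j, s j = 1 / (16 * (c (ξ j) : ℝ) ^ 2)) ∧
      IsSolUpTo F z (⨆ m, ENNReal.ofReal (∑ i ∈ Finset.range m, s i)) ∧
      (∀ j, ∀ t ∈ Ico (∑ i ∈ Finset.range j, s i) (∑ i ∈ Finset.range (j + 1), s i),
        δ / 2 ≤ ‖h (z t)‖) ∧
      ∀ j, dist (z (∑ i ∈ Finset.range j, s i)) (ξ j) ≤ (1 / 2) ^ j := by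
  have hc1 : ∀ ξ, (1:ℝ) ≤ c ξ := fun ξ => by exact_mod_cast (hc ξ).1
  let σ : EuclideanSpace ℝ (Fin n) → ℝ := fun ξ => 1 / (16 * (c ξ : ℝ) ^ 2)
  have hσ : ∀ ξ, 0 < σ ξ := fun ξ => by have := hc1 ξ; positivity
  have hcσ : ∀ ξ, c ξ * σ ξ = 1 / (16 * c ξ) := fun ξ => by
    have := hc1 ξ
    simp only [σ]; field_simp
  have hstep : ∀ ξ : {ξ // IsOutputPersistent F h δ ξ}, ∃ ξ' : {ξ // IsOutputPersistent F h δ ξ},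
      ∀ ε : ℝ, 0 < ε → ∃ x, IsSolUpTo F x ⊤ ∧ dist (x 0) ξ.1 < ε ∧ dist (x (σ ξ.1)) ξ'.1 < ε ∧
        ∀ t ∈ Icc 0 (σ ξ.1), δ ≤ ‖h (x t)‖ := by
    rintro ⟨ξ, hξ⟩
    obtain ⟨ξ', hξ', harc⟩ := hξ.exists_next (hc ξ) (hσ ξ).le (hcσ ξ).le
    exact ⟨⟨ξ', hξ'⟩, harc⟩
  choose next hnext using hstep
  let ξ : ℕ → EuclideanSpace ℝ (Fin n) := fun j => (next^[j] ⟨ξ₀, hξ₀⟩).1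
  have harc : ∀ j, ∀ ε : ℝ, 0 < ε → ∃ x, IsSolUpTo F x ⊤ ∧ dist (x 0) (ξ j) < ε ∧
      dist (x (σ (ξ j))) (ξ (j + 1)) < ε ∧ ∀ t ∈ Icc 0 (σ (ξ j)), δ ≤ ‖h (x t)‖ := by
    intro j
    simp only [ξ, Function.iterate_succ_apply']
    exact hnext _
  have hω : ∀ j, ∃ ω : ℝ, 0 < ω ∧ ∀ η ∈ closedBall (ξ j) 2, ∀ ζ ∈ closedBall (ξ j) 2,
      dist η ζ < ω → dist (h η) (h ζ) < δ / 2 := by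
    intro j
    obtain ⟨ω, hω, hωh⟩ := Metric.uniformContinuousOn_iff.1
      ((isCompact_closedBall (ξ j) 2).uniformContinuousOn_of_continuous hh.continuousOn)
      (δ / 2) (half_pos hδ)
    exact ⟨ω, hω, hωh⟩
  choose ω hω0 hωh using hω
  have hcinv : ∀ j, 0 < 1 / (c (ξ j) : ℝ) := fun j => one_div_pos.2 (by linarith [hc1 (ξ j)])
  have hcinv1 : ∀ j, 1 / (c (ξ j) : ℝ) ≤ 1 := fun j =>
    (div_le_one (by linarith [hc1 (ξ j)])).2 (hc1 (ξ j))
  obtain ⟨γ, hγ, hγ2, hγβ⟩ := exists_halving_sequence_le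
    (β := fun j => min (min (ω j / 2) (1 / c (ξ j) / 4)) ((1 / 2) ^ j) / 4)
    (fun j => by have := hω0 j; have := hcinv j; positivity)
  have hγω : ∀ j, 4 * γ j ≤ ω j / 2 := fun j => by
    have h1 : min (min (ω j / 2) (1 / (c (ξ j) : ℝ) / 4)) ((1 / 2) ^ j) ≤ ω j / 2 :=
      (min_le_left _ _).trans (min_le_left _ _)
    linarith [hγβ j]
  have hγc : ∀ j, 4 * γ j ≤ 1 / c (ξ j) / 4 := fun j => by
    have h1 : min (min (ω j / 2) (1 / (c (ξ j) : ℝ) / 4)) ((1 / 2) ^ j) ≤ 1 / c (ξ j) / 4 :=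
      (min_le_left _ _).trans (min_le_right _ _)
    linarith [hγβ j]
  have hγp : ∀ j, 4 * γ j ≤ (1 / 2) ^ j := fun j => by
    have h1 : min (min (ω j / 2) (1 / (c (ξ j) : ℝ) / 4)) ((1 / 2) ^ j) ≤ (1 / 2) ^ j :=
      min_le_right _ _
    linarith [hγβ j]
  choose q hq hqi hξ hqη hqF using fun j => exists_approximate_arc (hc (ξ j)) (hσ (ξ j))
    (hcσ (ξ j)).le (harc j) (ρ := min (γ j) (γ j / σ (ξ j) / 2))
    (lt_min (hγ j) (by have := hγ j; have := hσ (ξ j); positivity))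
  obtain ⟨z, hz, hzq⟩ := exists_isSolUpTo_near_concatenation hFne hFcpt (fun ξ => ⟨c ξ, hc ξ⟩)
    (s := fun j => σ (ξ j)) (c := fun j => c (ξ j)) (fun j => hc (ξ j)) (fun j => hσ (ξ j))
    (fun j => by
      have h1 := hcσ (ξ j)
      have h2 : 16 * (1 / (16 * (c (ξ j) : ℝ))) = 1 / c (ξ j) := by field_simp
      linarith [hcinv1 j])
    hγ hγ2 hγc hq hqi hξ
    (fun j t ht => by
      obtain ⟨η, hη, -, hqt⟩ := hqη j t ht
      have h1 := dist_triangle (ξ j + ∫ u in (0:ℝ)..t, q j u) η (ξ j)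
      have h2 := hqt.trans (min_le_right _ _)
      linarith)
    (fun j => by
      filter_upwards [hqF j] with t ht htj
      exact (ht htj).trans_le (min_le_right _ _))
  have hσsum : ∀ j, ∑ i ∈ Finset.range (j + 1), σ (ξ i) =
      ∑ i ∈ Finset.range j, σ (ξ i) + σ (ξ j) := fun j => Finset.sum_range_succ _ j
  refine ⟨fun j => σ (ξ j), ξ, z, fun j => rfl, hz, fun j t ht => ?_, fun j => ?_⟩
  · obtain ⟨η, hη, hδη, hqt⟩ := hqη j (t - ∑ i ∈ Finset.range j, σ (ξ i))
      ⟨sub_nonneg.2 ht.1, by linarith [ht.2, hσsum j]⟩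
    have h1 := hzq j t ht
    have h2 := hqt.trans ((min_le_left _ _).trans (min_le_left _ _))
    have h3 := dist_triangle (z t)
      (ξ j + ∫ u in (0:ℝ)..(t - ∑ i ∈ Finset.range j, σ (ξ i)), q j u) η
    have h4 := dist_triangle (z t) η (ξ j)
    have h5 := hωh j (z t) (by rw [mem_closedBall]; linarith [hcinv1 j, hγc j, hγ j]) η
      (by rw [mem_closedBall]; linarith [hcinv1 j]) (by linarith [hγω j, hω0 j])
    rw [dist_comm, dist_eq_norm] at h5
    linarith [norm_sub_norm_le (h η) (h (z t))]
  · have h1 := hzq j (∑ i ∈ Finset.range j, σ (ξ i))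
      ⟨le_rfl, by linarith [hσsum j, hσ (ξ j)]⟩
    rw [sub_self, intervalIntegral.integral_same, add_zero] at h1
    exact h1.trans (hγp j)

/-- For forward complete systems the solution issued from an output-persistent point is global. -/
theorem IsOutputPersistent.exists_isSolUpTo_top {n p : ℕ}
    {F : EuclideanSpace ℝ (Fin n) → Set (EuclideanSpace ℝ (Fin n))}
    (hFne : ∀ ξ, (F ξ).Nonempty) (hFcpt : ∀ ξ, IsCompact (F ξ))
    (hF : ∀ ξ, ∃ c, IsLocalBound F ξ c)
    {h : EuclideanSpace ℝ (Fin n) → EuclideanSpace ℝ (Fin p)} (hh : Continuous h)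
    (hfc : ∀ (x : ℝ → EuclideanSpace ℝ (Fin n)) (T : ℝ≥0∞), IsMaxSol F x T → T = ⊤)
    {δ : ℝ} (hδ : 0 < δ) {ξ₀ : EuclideanSpace ℝ (Fin n)} (hξ₀ : IsOutputPersistent F h δ ξ₀) :
    ∃ z, IsSolUpTo F z ⊤ ∧ ∀ t, 0 ≤ t → δ / 2 ≤ ‖h (z t)‖ := by
  classical
  obtain ⟨s, ξ, z, hs, hz, hzh, hzξ⟩ := hξ₀.exists_isSolUpTo hFne hFcpt hh
    (fun ξ => Nat.find_spec (hF ξ)) hδ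
  have hs0 : ∀ j, 0 < s j := fun j => by
    have h1 : (1:ℝ) ≤ (Nat.find (hF (ξ j)) : ℕ) := by exact_mod_cast (Nat.find_spec (hF (ξ j))).1
    rw [hs j]
    positivity
  have hmono : Monotone fun m => ∑ i ∈ Finset.range m, s i := monotone_nat_of_le_succ fun m => by
    rw [Finset.sum_range_succ]
    exact le_add_of_nonneg_right (hs0 m).le
  have hnonneg : ∀ m, 0 ≤ ∑ i ∈ Finset.range m, s i := fun m =>
    Finset.sum_nonneg fun i _ => (hs0 i).le
  have hlt : ∀ m, ENNReal.ofReal (∑ i ∈ Finset.range m, s i) <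
      ⨆ m, ENNReal.ofReal (∑ i ∈ Finset.range m, s i) := fun m =>
    lt_iSup_iff.2 ⟨m + 1, (ENNReal.ofReal_lt_ofReal_iff (by
      rw [Finset.sum_range_succ]; linarith [hnonneg m, hs0 m])).2 (by
      rw [Finset.sum_range_succ]; linarith [hs0 m])⟩
  have htop : (⨆ m, ENNReal.ofReal (∑ i ∈ Finset.range m, s i)) = ⊤ := by
    refine hfc z _ ⟨(hlt 0).trans_le' zero_le, hz, ?_⟩
    rintro ⟨T', y, hT', hy, hyz⟩
    have hsum : ∀ m, ∑ i ∈ Finset.range m, s i ≤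
        (⨆ m, ENNReal.ofReal (∑ i ∈ Finset.range m, s i)).toReal := fun m =>
      (ENNReal.ofReal_le_iff_le_toReal hT'.ne_top).1 (hlt m).le
    have hconv := tendsto_atTop_ciSup hmono ⟨_, forall_mem_range.2 hsum⟩
    set τ := ⨆ m, ∑ i ∈ Finset.range m, s i
    have hτ : ∀ m, ∑ i ∈ Finset.range m, s i ≤ τ := fun m => hmono.ge_of_tendsto hconv m
    have hτ0 : 0 ≤ τ := (hnonneg 0).trans (hτ 0)
    have hτT : ENNReal.ofReal τ < T' :=
      (ENNReal.ofReal_le_iff_le_toReal hT'.ne_top).2 (ciSup_le hsum) |>.trans_lt hT'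
    have hyτ : Filter.Tendsto (fun m => y (∑ i ∈ Finset.range m, s i)) Filter.atTop
        (nhds (y τ)) :=
      ((hy.continuousOn hτ0 hτT) τ (right_mem_Icc.2 hτ0)).tendsto.comp
        (tendsto_nhdsWithin_iff.2
          ⟨hconv, Filter.Eventually.of_forall fun m => ⟨hnonneg m, hτ m⟩⟩)
    have hξτ : Filter.Tendsto ξ Filter.atTop (nhds (y τ)) := by
      refine tendsto_of_tendsto_of_dist hyτ (squeeze_zero (fun _ => dist_nonneg) (fun j => ?_)
        (tendsto_pow_atTop_nhds_zero_of_lt_one (r := (1 / 2 : ℝ)) (by norm_num) (by norm_num)))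
      rw [hyz _ (hnonneg j) (hlt j)]
      exact hzξ j
    obtain ⟨c, hc⟩ := hF (y τ)
    have hc1 : (1:ℝ) ≤ c := by exact_mod_cast hc.1
    have hs_tendsto : Filter.Tendsto s Filter.atTop (nhds 0) := by
      have h1 := (hconv.comp (Filter.tendsto_add_atTop_nat 1)).sub hconv
      rw [sub_self] at h1
      refine h1.congr fun m => ?_
      simp [Finset.sum_range_succ]
    obtain ⟨j, hj, hsj⟩ := ((hξτ.eventually (closedBall_mem_nhds (y τ)
      (ε := 1 / (2 * c)) (by positivity))).and (hs_tendsto.eventually_lt_const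
      (u := 1 / (16 * (2 * (c:ℝ)) ^ 2)) (by positivity))).exists
    have hfind : ((Nat.find (hF (ξ j)) : ℕ) : ℝ) ≤ 2 * c := by
      exact_mod_cast Nat.find_min' (hF (ξ j)) (hc.of_dist_le hj)
    have hfind1 : (1:ℝ) ≤ (Nat.find (hF (ξ j)) : ℕ) := by
      exact_mod_cast (Nat.find_spec (hF (ξ j))).1
    rw [hs j] at hsj
    refine absurd hsj (not_lt.2 ?_)
    gcongr
  rw [htop] at hz
  refine ⟨z, hz, fun t ht => ?_⟩
  obtain ⟨m, hm⟩ := lt_iSup_iff.1 (htop ▸ ENNReal.ofReal_lt_top (r := t))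
  obtain ⟨j, hj⟩ := exists_mem_Ico_sum ht (ENNReal.lt_ofReal_iff_toReal_lt
    ENNReal.ofReal_ne_top |>.1 hm |>.trans_eq' (ENNReal.toReal_ofReal ht))
  exact hzh j t hj

/-- **Proposition 5.3**: for a forward complete system `ẋ ∈ F(x)`, `y = h(x)` on `ℝⁿ`,
with `F` locally Lipschitz with nonempty compact values and `h` continuous,
output-global asymptotic stability is equivalent to uniform output-global asymptotic
stability. -/
theorem oGAS_iff_oUGAS {n p : ℕ}
    (F : EuclideanSpace ℝ (Fin n) → Set (EuclideanSpace ℝ (Fin n)))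
    (hFne : ∀ ξ, (F ξ).Nonempty)
    (hFcpt : ∀ ξ, IsCompact (F ξ))
    (hFlip : ∀ ξ : EuclideanSpace ℝ (Fin n), ∃ U ∈ nhds ξ, ∃ k : ℝ,
      ∀ η ∈ U, ∀ ζ ∈ U, hausdorffDist (F η) (F ζ) ≤ k * ‖η - ζ‖)
    (h : EuclideanSpace ℝ (Fin n) → EuclideanSpace ℝ (Fin p))
    (hh : Continuous h)
    -- forward completeness: every maximal solution is defined on all of `[0,∞)`
    (hfc : ∀ (x : ℝ → EuclideanSpace ℝ (Fin n)) (T : ℝ≥0∞), IsMaxSol F x T → T = ⊤) :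
    oGAS F h ↔ oUGAS F h := by
  have hF := exists_isLocalBound hFne hFcpt hFlip
  have hsol : ∀ {C : Set (EuclideanSpace ℝ (Fin n))} {x}, x ∈ MaxSols F C → IsSolUpTo F x ⊤ := by
    rintro C x ⟨⟨T, hx⟩, -⟩
    exact hfc x T hx ▸ hx.2.1
  have hmax : ∀ {x}, IsSolUpTo F x ⊤ → x ∈ MaxSols F univ := fun hx =>
    ⟨⟨⊤, hx.isMaxSol⟩, mem_univ _⟩
  constructor
  · rintro ⟨hstab, hattr⟩
    refine ⟨hstab, fun κ _ ε hε => ?_⟩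
    by_contra! hcon
    obtain ⟨δ, hδ, hδε⟩ := hstab ε hε
    choose x hxS t ht hxt using fun k : ℕ => hcon ((k:ℝ) + 1) (by positivity)
    have hxh : ∀ k : ℕ, ∀ τ ∈ Icc (0:ℝ) k, δ ≤ ‖h (x k τ)‖ := by
      intro k τ hτ
      by_contra! hlt
      have h1 := hδε _ (hmax ((hsol (hxS k)).shift hτ.1)) (by simpa using hlt.le) (t k - τ)
        (by linarith [hτ.2, ht k])
      rw [add_sub_cancel] at h1
      exact absurd h1 (not_le.2 (hxt k))
    obtain ⟨ξ, hξ, -⟩ := exists_isOutputPersistent_of_isCompact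
      (isCompact_closedBall (0 : EuclideanSpace ℝ (Fin n)) κ) (fun k => hsol (hxS k))
      (fun k => (hxS k).2) hxh
    obtain ⟨z, hz, hzh⟩ := hξ.exists_isSolUpTo_top hFne hFcpt hF hh hfc hδ
    obtain ⟨τ, hτ, hτ0⟩ := (((hattr z (hmax hz)).eventually_lt_const (half_pos hδ)).and
      (Filter.eventually_ge_atTop 0)).exists
    exact absurd hτ (not_lt.2 (hzh τ hτ0))
  · rintro ⟨hstab, hunif⟩
    refine ⟨hstab, fun x hx => Metric.tendsto_atTop.2 fun ε hε => ?_⟩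
    obtain ⟨T, -, hT⟩ := hunif (‖x 0‖ + 1) (by positivity) (ε / 2) (half_pos hε)
    refine ⟨T, fun t ht => ?_⟩
    rw [Real.dist_0_eq_abs, abs_norm]
    exact (hT x ⟨hx.1, mem_closedBall_zero_iff.2 (by linarith)⟩ t ht).trans_lt (half_lt_self hε)
end

section
/- Let x = (x₁, x₂, x₃) : [0,∞) → ℝ³ be a solution of the system ẋ₁(t) = x₂(t)², ẋ₂(t) = x₃(t)², ẋ₃(t) ∈ {−1, 1} with x(0) = 0, and set σ := x₂(1) = ∫₀¹ x₃(t)² dt. Then σ > 0, x₂(t) ≥ σ for all t ≥ 1, and x₁(t) ≥ σ²(t − 1) for all t ≥ 1. -/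
open MeasureTheory Set

/-- If the primitive of an interval integrable function vanishes identically, so does the function,
almost everywhere. -/
theorem ae_eq_zero_of_primitive_eq_zero {f : ℝ → ℝ} {a b : ℝ} (hf : IntervalIntegrable f volume a b)
    (h : ∀ t ∈ Icc a b, ∫ s in a..t, f s = 0) : ∀ᵐ t : ℝ, t ∈ Ioo a b → f t = 0 := by
  filter_upwards [hf.ae_hasDerivAt_integral] with t ht hmem
  have hab : a ≤ b := (hmem.1.trans hmem.2).le
  have hderiv : HasDerivAt (fun u => ∫ s in a..u, f s) (f t) t :=
    ht (by rw [uIcc_of_le hab]; exact Ioo_subset_Icc_self hmem) a left_mem_uIcc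
  have hzero : (fun u => ∫ s in a..u, f s) =ᶠ[nhds t] fun _ => 0 := by
    filter_upwards [Ioo_mem_nhds hmem.1 hmem.2] with u hu
    exact h u (Ioo_subset_Icc_self hu)
  exact hderiv.unique ((hasDerivAt_const t (0 : ℝ)).congr_of_eventuallyEq hzero)

/-- A function agreeing on `[0, ∞)` with `c` plus the primitive of a locally integrable function is
continuous on every `[0, t]`. -/
theorem continuousOn_of_eq_primitive {f g : ℝ → ℝ} {c : ℝ}
    (hf : ∀ t : ℝ, 0 ≤ t → IntegrableOn f (Icc 0 t))
    (hg : ∀ t : ℝ, 0 ≤ t → g t = c + ∫ s in (0 : ℝ)..t, f s) {t : ℝ} (ht : 0 ≤ t) :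
    ContinuousOn g (Icc 0 t) := by
  have hprim : ContinuousOn (fun u => ∫ s in (0 : ℝ)..u, f s) (Icc 0 t) := by
    have := intervalIntegral.continuousOn_primitive_interval (f := f) (μ := volume) (a := 0) (b := t)
      (by rw [uIcc_of_le ht]; exact hf t ht)
    rwa [uIcc_of_le ht] at this
  exact (continuousOn_const.add hprim).congr fun u hu => hg u hu.1

/-- For any solution `x = (x₁,x₂,x₃)` on `[0,∞)` of
`ẋ₁ = x₂²`, `ẋ₂ = x₃²`, `ẋ₃ ∈ {-1,1}` with `x(0) = 0`
(each component absolutely continuous, i.e. an indefinite integral, with `x₃` the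
integral of a locally integrable `v` taking values in `{-1,1}` a.e.), setting
`σ := ∫₀¹ x₃(t)² dt`, one has `x₂ 1 = σ`, `σ > 0`, `x₂ t ≥ σ` for all `t ≥ 1`, and
`x₁ t ≥ σ² (t - 1)` for all `t ≥ 1`. -/
theorem counterexample_growth_estimates
    (x₁ x₂ x₃ v : ℝ → ℝ)
    (hx₁0 : x₁ 0 = 0) (hx₂0 : x₂ 0 = 0) (hx₃0 : x₃ 0 = 0)
    (hv_int : ∀ t : ℝ, 0 ≤ t → IntegrableOn v (Icc (0:ℝ) t))
    (hv : ∀ᵐ t : ℝ, 0 ≤ t → v t ∈ ({-1, 1} : Set ℝ))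
    (hx₃ : ∀ t : ℝ, 0 ≤ t → x₃ t = x₃ 0 + ∫ s in (0:ℝ)..t, v s)
    (hx₂ : ∀ t : ℝ, 0 ≤ t → x₂ t = x₂ 0 + ∫ s in (0:ℝ)..t, (x₃ s) ^ 2)
    (hx₁ : ∀ t : ℝ, 0 ≤ t → x₁ t = x₁ 0 + ∫ s in (0:ℝ)..t, (x₂ s) ^ 2)
    (σ : ℝ) (hσ : σ = ∫ t in (0:ℝ)..1, (x₃ t) ^ 2) :
    x₂ 1 = σ ∧ 0 < σ ∧ (∀ t : ℝ, 1 ≤ t → σ ≤ x₂ t) ∧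
      (∀ t : ℝ, 1 ≤ t → σ ^ 2 * (t - 1) ≤ x₁ t) := by
  have hcont₃ : ∀ t : ℝ, 0 ≤ t → ContinuousOn (fun s => x₃ s ^ 2) (Icc 0 t) := fun t ht =>
    (continuousOn_of_eq_primitive hv_int hx₃ ht).pow 2
  have hcont₂ : ∀ t : ℝ, 0 ≤ t → ContinuousOn (fun s => x₂ s ^ 2) (Icc 0 t) := fun t ht =>
    (continuousOn_of_eq_primitive (fun u hu => (hcont₃ u hu).integrableOn_Icc) hx₂ ht).pow 2
  have hx₂one : x₂ 1 = σ := by rw [hx₂ 1 zero_le_one, hx₂0, zero_add, hσ]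
  have hσpos : 0 < σ := by
    rw [hσ]
    refine intervalIntegral.integral_pos zero_lt_one (hcont₃ 1 zero_le_one)
      (fun s _ => sq_nonneg _) ?_
    by_contra! hle
    have hzero : ∀ t ∈ Icc (0 : ℝ) 1, ∫ s in (0 : ℝ)..t, v s = 0 := fun t ht => by
      have h := hx₃ t ht.1
      rw [hx₃0, zero_add] at h
      rw [← h]
      exact pow_eq_zero_iff two_ne_zero |>.1 (le_antisymm (hle t ht) (sq_nonneg _))
    have hv₁ : IntervalIntegrable v volume 0 1 :=
      (intervalIntegrable_iff_integrableOn_Icc_of_le zero_le_one).2 (hv_int 1 zero_le_one)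
    have hnull : ∀ᵐ t : ℝ, t ∉ Ioo (0 : ℝ) 1 := by
      filter_upwards [ae_eq_zero_of_primitive_eq_zero hv₁ hzero, hv] with t h₀ h₁ hmem
      have h := h₁ hmem.1.le
      rw [h₀ hmem] at h
      norm_num at h
    have hvol : volume (Ioo (0 : ℝ) 1) = 0 := measure_eq_zero_iff_ae_notMem.2 hnull
    norm_num at hvol
  have hx₂ge : ∀ t : ℝ, 1 ≤ t → σ ≤ x₂ t := fun t ht => by
    have ht₀ : (0 : ℝ) ≤ t := zero_le_one.trans ht
    rw [hx₂ t ht₀, hx₂0, zero_add, hσ]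
    exact intervalIntegral.integral_mono_interval le_rfl zero_le_one ht
      (ae_of_all _ fun s => sq_nonneg _)
      ((hcont₃ t ht₀).intervalIntegrable_of_Icc ht₀)
  refine ⟨hx₂one, hσpos, hx₂ge, fun t ht => ?_⟩
  have ht₀ : (0 : ℝ) ≤ t := zero_le_one.trans ht
  have hint : IntervalIntegrable (fun s => x₂ s ^ 2) volume 0 t :=
    (hcont₂ t ht₀).intervalIntegrable_of_Icc ht₀
  calc σ ^ 2 * (t - 1) = ∫ _ in (1 : ℝ)..t, σ ^ 2 := by
        rw [intervalIntegral.integral_const, smul_eq_mul, mul_comm]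
    _ ≤ ∫ s in (1 : ℝ)..t, x₂ s ^ 2 :=
        intervalIntegral.integral_mono_on ht intervalIntegrable_const
          (((hcont₂ t ht₀).mono (Icc_subset_Icc_left zero_le_one)).intervalIntegrable_of_Icc ht)
          fun s hs => pow_le_pow_left₀ hσpos.le (hx₂ge s hs.1) 2
    _ ≤ ∫ s in (0 : ℝ)..t, x₂ s ^ 2 :=
        intervalIntegral.integral_mono_interval zero_le_one ht le_rfl
          (ae_of_all _ fun s => sq_nonneg _) hint
    _ = x₁ t := by rw [hx₁ t ht₀, hx₁0, zero_add]
end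

section
/- For every ε > 0, there is no solution x = (x₁, x₂, x₃) : [0,∞) → ℝ³ of the system ẋ₁(t) = x₂(t)², ẋ₂(t) = x₃(t)², ẋ₃(t) ∈ {−1, 1} with x(0) = 0 that satisfies |x(t)| ≤ ε for all t ≥ 0. In fact, every such solution with x(0) = 0 satisfies x₁(t) → ∞ as t → ∞. -/
open MeasureTheory Set

/-- `(x₁,x₂,x₃)` is a solution on `[0,∞)` of `ẋ₁ = x₂²`, `ẋ₂ = x₃²`, `ẋ₃ ∈ {-1,1}`:
each component is absolutely continuous (an indefinite integral), with `x₃` the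
integral of a locally integrable `v` taking values in `{-1,1}` almost everywhere. -/
def IsSol3 (x₁ x₂ x₃ v : ℝ → ℝ) : Prop :=
  (∀ t : ℝ, 0 ≤ t → IntegrableOn v (Icc (0:ℝ) t)) ∧
  (∀ᵐ t : ℝ, 0 ≤ t → v t ∈ ({-1, 1} : Set ℝ)) ∧
  (∀ t : ℝ, 0 ≤ t → x₃ t = x₃ 0 + ∫ s in (0:ℝ)..t, v s) ∧
  (∀ t : ℝ, 0 ≤ t → x₂ t = x₂ 0 + ∫ s in (0:ℝ)..t, (x₃ s) ^ 2) ∧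
  (∀ t : ℝ, 0 ≤ t → x₁ t = x₁ 0 + ∫ s in (0:ℝ)..t, (x₂ s) ^ 2)

/-- A function whose primitive vanishes on `[0,1]` cannot take values in `{-1,1}` almost
everywhere. -/
lemma exists_primitive_ne_zero {v : ℝ → ℝ} (hint : IntervalIntegrable v volume 0 1)
    (hv : ∀ᵐ t : ℝ, 0 ≤ t → v t ∈ ({-1, 1} : Set ℝ)) :
    ∃ c ∈ Icc (0:ℝ) 1, ∫ s in (0:ℝ)..c, v s ≠ 0 := by
  by_contra! h
  have hne : ∀ᵐ x : ℝ, x ∉ Ioo (0:ℝ) 1 := by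
    filter_upwards [hint.ae_hasDerivAt_integral, hv] with x hder hvx hx
    have hd := hder (by rw [uIcc_of_le zero_le_one]; exact Ioo_subset_Icc_self hx) 0 (by simp)
    have hz : (fun y => ∫ s in (0:ℝ)..y, v s) =ᶠ[nhds x] fun _ => 0 := by
      filter_upwards [Ioo_mem_nhds hx.1 hx.2] with y hy
      exact h y (Ioo_subset_Icc_self hy)
    have hv0 : v x = 0 := hd.unique ((hasDerivAt_const x (0:ℝ)).congr_of_eventuallyEq hz)
    simpa [hv0] using hvx hx.1.le
  have hvol : volume (Ioo (0:ℝ) 1) = 0 := by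
    simpa only [ae_iff, not_not, ofPred_mem_eq] using hne
  simp at hvol

namespace IsSol3

variable {x₁ x₂ x₃ v : ℝ → ℝ}

lemma continuousOn_third (h : IsSol3 x₁ x₂ x₃ v) {T : ℝ} (hT : 0 ≤ T) :
    ContinuousOn x₃ (Icc 0 T) := by
  have hc := intervalIntegral.continuousOn_primitive_interval (f := v) (μ := volume)
    (a := 0) (b := T) (by rw [uIcc_of_le hT]; exact h.1 T hT)
  rw [uIcc_of_le hT] at hc
  exact (hc.const_add (x₃ 0)).congr fun t ht => h.2.2.1 t ht.1

lemma continuousOn_second (h : IsSol3 x₁ x₂ x₃ v) {T : ℝ} (hT : 0 ≤ T) :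
    ContinuousOn x₂ (Icc 0 T) := by
  have hc := intervalIntegral.continuousOn_primitive_interval (f := fun s => x₃ s ^ 2)
    (μ := volume) (a := 0) (b := T)
    (by rw [uIcc_of_le hT]; exact ((h.continuousOn_third hT).pow 2).integrableOn_Icc)
  rw [uIcc_of_le hT] at hc
  exact (hc.const_add (x₂ 0)).congr fun t ht => h.2.2.2.1 t ht.1

lemma intervalIntegrable_third_sq (h : IsSol3 x₁ x₂ x₃ v) {a b : ℝ} (ha : 0 ≤ a) (hab : a ≤ b) :
    IntervalIntegrable (fun s => x₃ s ^ 2) volume a b :=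
  (((h.continuousOn_third (ha.trans hab)).pow 2).mono
    (Icc_subset_Icc_left ha)).intervalIntegrable_of_Icc hab

lemma intervalIntegrable_second_sq (h : IsSol3 x₁ x₂ x₃ v) {a b : ℝ} (ha : 0 ≤ a) (hab : a ≤ b) :
    IntervalIntegrable (fun s => x₂ s ^ 2) volume a b :=
  (((h.continuousOn_second (ha.trans hab)).pow 2).mono
    (Icc_subset_Icc_left ha)).intervalIntegrable_of_Icc hab

lemma second_le_second (h : IsSol3 x₁ x₂ x₃ v) {a b : ℝ} (ha : 0 ≤ a) (hab : a ≤ b) :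
    x₂ a ≤ x₂ b := by
  rw [h.2.2.2.1 a ha, h.2.2.2.1 b (ha.trans hab), ← intervalIntegral.integral_add_adjacent_intervals
    (h.intervalIntegrable_third_sq le_rfl ha) (h.intervalIntegrable_third_sq ha hab)]
  have := intervalIntegral.integral_nonneg (μ := volume) hab fun s _ => sq_nonneg (x₃ s)
  linarith

lemma second_one_pos (h : IsSol3 x₁ x₂ x₃ v) (h₂ : x₂ 0 = 0) (h₃ : x₃ 0 = 0) : 0 < x₂ 1 := by
  obtain ⟨c, hc, hne⟩ := exists_primitive_ne_zero
    ((intervalIntegrable_iff_integrableOn_Icc_of_le zero_le_one).2 (h.1 1 zero_le_one)) h.2.1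
  have hc₃ : x₃ c ≠ 0 := by rwa [h.2.2.1 c hc.1, h₃, zero_add]
  rw [h.2.2.2.1 1 zero_le_one, h₂, zero_add]
  exact intervalIntegral.integral_pos zero_lt_one ((h.continuousOn_third zero_le_one).pow 2)
    (fun s _ => sq_nonneg (x₃ s)) ⟨c, hc, by positivity⟩

lemma tendsto_first_atTop (h : IsSol3 x₁ x₂ x₃ v) (h₂ : x₂ 0 = 0) (h₃ : x₃ 0 = 0) :
    Filter.Tendsto x₁ Filter.atTop Filter.atTop := by
  have hpos := h.second_one_pos h₂ h₃
  have hlin : Filter.Tendsto (fun t : ℝ => x₁ 1 + (t - 1) * x₂ 1 ^ 2) Filter.atTop Filter.atTop :=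
    Filter.tendsto_atTop_add_const_left _ _ <|
      (Filter.tendsto_atTop_add_const_right _ (-1 : ℝ) Filter.tendsto_id).atTop_mul_const
        (by positivity)
  refine Filter.tendsto_atTop_mono' _ ?_ hlin
  filter_upwards [Filter.eventually_ge_atTop (1:ℝ)] with t ht
  have hle : ∫ _ in (1:ℝ)..t, x₂ 1 ^ 2 ≤ ∫ s in (1:ℝ)..t, x₂ s ^ 2 :=
    intervalIntegral.integral_mono_on ht (by simp)
      (h.intervalIntegrable_second_sq zero_le_one ht) fun s hs =>
        pow_le_pow_left₀ hpos.le (h.second_le_second zero_le_one hs.1) 2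
  rw [intervalIntegral.integral_const, smul_eq_mul] at hle
  rw [h.2.2.2.2 t (zero_le_one.trans ht), h.2.2.2.2 1 zero_le_one,
    ← intervalIntegral.integral_add_adjacent_intervals
      (h.intervalIntegrable_second_sq le_rfl zero_le_one)
      (h.intervalIntegrable_second_sq zero_le_one ht)]
  linarith

end IsSol3

/-- For every `ε > 0` there is no solution of `ẋ₁ = x₂²`, `ẋ₂ = x₃²`, `ẋ₃ ∈ {-1,1}`
with `x(0) = 0` whose Euclidean norm stays `≤ ε` for all `t ≥ 0`; in fact every
solution with `x(0) = 0` satisfies `x₁ t → ∞` as `t → ∞`. -/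
theorem no_bounded_solution_from_origin :
    (∀ ε : ℝ, 0 < ε →
      ¬ ∃ x₁ x₂ x₃ v : ℝ → ℝ, IsSol3 x₁ x₂ x₃ v ∧
          x₁ 0 = 0 ∧ x₂ 0 = 0 ∧ x₃ 0 = 0 ∧
          ∀ t : ℝ, 0 ≤ t →
            Real.sqrt ((x₁ t) ^ 2 + (x₂ t) ^ 2 + (x₃ t) ^ 2) ≤ ε) ∧
    (∀ x₁ x₂ x₃ v : ℝ → ℝ, IsSol3 x₁ x₂ x₃ v →
      x₁ 0 = 0 → x₂ 0 = 0 → x₃ 0 = 0 →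
      Filter.Tendsto x₁ Filter.atTop Filter.atTop) := by
  refine ⟨?_, fun x₁ x₂ x₃ v h _ h₂ h₃ => h.tendsto_first_atTop h₂ h₃⟩
  rintro ε - ⟨x₁, x₂, x₃, v, h, -, h₂, h₃, hb⟩
  obtain ⟨t, ht, ht0⟩ := ((h.tendsto_first_atTop h₂ h₃).eventually_gt_atTop ε |>.and
    (Filter.eventually_ge_atTop 0)).exists
  have hle : x₁ t ≤ Real.sqrt (x₁ t ^ 2 + x₂ t ^ 2 + x₃ t ^ 2) :=
    Real.le_sqrt_of_sq_le (by nlinarith [sq_nonneg (x₂ t), sq_nonneg (x₃ t)])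
  linarith [hb t ht0]
end

section
/- For every ε > 0, there exist η ∈ ℝ³ with |η| ≤ ε and a solution x = (x₁, x₂, x₃) : [0,∞) → ℝ³ of the system ẋ₁(t) = x₂(t)², ẋ₂(t) = x₃(t)², ẋ₃(t) ∈ {−1, 1} with x(0) = η such that |x(t)| ≤ ε for all t ≥ 0. -/
open MeasureTheory Set

open Filter Topology

/-- Wherever the distance function to a closed set of reals is differentiable outside that set,
its derivative is `-1` or `1`. -/
theorem deriv_infDist_mem_of_notMem {S : Set ℝ} (hS : IsClosed S) (hne : S.Nonempty) {t : ℝ}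
    (ht : t ∉ S) (hd : DifferentiableAt ℝ (fun y => Metric.infDist y S) t) :
    deriv (fun y => Metric.infDist y S) t ∈ ({-1, 1} : Set ℝ) := by
  obtain ⟨p, hp, hpt⟩ := hS.exists_infDist_eq_dist hne t
  have hle (y : ℝ) : Metric.infDist y S ≤ |y - p| := Metric.infDist_le_dist_of_mem hp
  have hge (y : ℝ) : |t - p| ≤ Metric.infDist y S + |t - y| :=
    hpt.symm.trans_le Metric.infDist_le_infDist_add_dist
  have hne' : p ≠ t := fun h => ht (h ▸ hp)
  rcases hne'.lt_or_gt with h | h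
  · right
    have heq : ∀ y ∈ Icc p t, Metric.infDist y S = y - p := fun y hy => by
      have h1 := hle y
      have h2 := hge y
      rw [abs_of_nonneg (by linarith [hy.1])] at h1
      rw [abs_of_pos (by linarith), abs_of_nonneg (by linarith [hy.2])] at h2
      linarith
    have hderiv : HasDerivWithinAt (fun y => Metric.infDist y S) 1 (Icc p t) t :=
      ((hasDerivAt_id t).sub_const p).hasDerivWithinAt.congr heq (heq t (right_mem_Icc.2 h.le))
    exact (uniqueDiffOn_Icc h t (right_mem_Icc.2 h.le)).eq_deriv _
      hd.hasDerivAt.hasDerivWithinAt hderiv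
  · left
    have heq : ∀ y ∈ Icc t p, Metric.infDist y S = p - y := fun y hy => by
      have h1 := hle y
      have h2 := hge y
      rw [abs_of_nonpos (by linarith [hy.2])] at h1
      rw [abs_of_neg (by linarith), abs_of_nonpos (by linarith [hy.1])] at h2
      linarith
    have hderiv : HasDerivWithinAt (fun y => Metric.infDist y S) (-1) (Icc t p) t :=
      ((hasDerivAt_id t).const_sub p).hasDerivWithinAt.congr heq (heq t (left_mem_Icc.2 h.le))
    exact (uniqueDiffOn_Icc h t (left_mem_Icc.2 h.le)).eq_deriv _
      hd.hasDerivAt.hasDerivWithinAt hderiv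

/-- A continuous function dominated by `A / (c + t) ^ 2` on `[0, ∞)` has a nonpositive
antiderivative of size at most `A / (c + t)`. -/
theorem exists_antideriv_of_le_div_sq {g : ℝ → ℝ} {A c : ℝ} (hA : 0 ≤ A) (hc : 0 < c)
    (hg : Continuous g) (hg0 : ∀ t, 0 ≤ g t) (hgA : ∀ t, 0 ≤ t → g t ≤ A / (c + t) ^ 2) :
    ∃ X : ℝ → ℝ, Continuous X ∧ (∀ t, X t = X 0 + ∫ s in (0 : ℝ)..t, g s) ∧
      ∀ t, 0 ≤ t → |X t| ≤ A / (c + t) := by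
  have hderiv : ∀ t : ℝ, 0 ≤ t → ∀ y ∈ Ici t,
      HasDerivAt (fun y => -(A / (c + y))) (A / (c + y) ^ 2) y := fun t ht y hy => by
    have hy' : c + y ≠ 0 := by linarith [mem_Ici.1 hy]
    convert! (((hasDerivAt_id y).const_add c).fun_inv hy').const_mul (-A) using 1
    · ext z; simp [div_eq_mul_inv]
    · simp; field_simp
  have hlim : Tendsto (fun y => -(A / (c + y))) atTop (𝓝 0) := by
    simpa using (tendsto_const_nhds.div_atTop (tendsto_atTop_add_const_left _ c tendsto_id)).neg
  have hpos : ∀ t : ℝ, ∀ y ∈ Ioi t, 0 ≤ A / (c + y) ^ 2 := fun t y _ => by positivity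
  have hint (t : ℝ) (ht : 0 ≤ t) : IntegrableOn (fun y => A / (c + y) ^ 2) (Ioi t) :=
    integrableOn_Ioi_deriv_of_nonneg' (hderiv t ht) (hpos t) hlim
  have hgint (t : ℝ) (ht : 0 ≤ t) : IntegrableOn g (Ioi t) := by
    refine (hint t ht).mono' hg.aestronglyMeasurable ?_
    filter_upwards [self_mem_ae_restrict measurableSet_Ioi] with y hy
    rw [Real.norm_of_nonneg (hg0 y)]
    exact hgA y (ht.trans (mem_Ioi.1 hy).le)
  refine ⟨fun t => -(∫ s in Ioi 0, g s) + ∫ s in (0 : ℝ)..t, g s, ?_, fun t => by simp, ?_⟩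
  · exact continuous_const.add
      (intervalIntegral.continuous_primitive (fun a b => hg.intervalIntegrable a b) 0)
  · intro t ht
    have hsplit := intervalIntegral.integral_interval_add_Ioi (hgint 0 le_rfl) (hgint t ht)
    have hnonneg : 0 ≤ ∫ s in Ioi t, g s := integral_nonneg hg0
    have hle : ∫ s in Ioi t, g s ≤ A / (c + t) := by
      calc ∫ s in Ioi t, g s ≤ ∫ s in Ioi t, A / (c + s) ^ 2 :=
            setIntegral_mono_on (hgint t ht) (hint t ht) measurableSet_Ioi
              fun y hy => hgA y (ht.trans (mem_Ioi.1 hy).le)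
        _ = A / (c + t) := by
            rw [integral_Ioi_of_hasDerivAt_of_nonneg' (hderiv t ht) (hpos t) hlim]; ring
    rw [abs_le]
    constructor <;> linarith

/-- There is a nonnegative `1`-Lipschitz function with slope `±1` almost everywhere on `[0, ∞)`
that decays like `1 / t`, namely the distance to `{c √n : n ∈ ℕ}`. -/
theorem exists_zigzag {c : ℝ} (hc : 0 < c) :
    ∃ f : ℝ → ℝ, LipschitzWith 1 f ∧
      (∀ᵐ t : ℝ, 0 ≤ t → deriv f t ∈ ({-1, 1} : Set ℝ)) ∧
      ∀ t, 0 ≤ t → 0 ≤ f t ∧ f t ≤ c ∧ f t ≤ 2 * c ^ 2 / (c + t) := by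
  let S : Set ℝ := {t | t ^ 2 / c ^ 2 ∈ range ((↑) : ℕ → ℝ)}
  have hS : IsClosed S := Nat.isClosedEmbedding_coe_real.isClosed_range.preimage (by fun_prop)
  have hmem (n : ℕ) : c * √n ∈ S :=
    ⟨n, by rw [mul_pow, Real.sq_sqrt n.cast_nonneg]; field_simp⟩
  have hcount : (S ∩ Ici 0).Countable := by
    refine (countable_range fun n : ℕ => c * √n).mono ?_
    rintro t ⟨⟨n, hn⟩, ht⟩
    refine ⟨n, ?_⟩
    simp only [hn]
    rw [← div_pow, Real.sqrt_sq (div_nonneg ht hc.le)]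
    field_simp
  have hlip : LipschitzWith 1 (fun t => Metric.infDist t S) := Metric.lipschitz_infDist_pt S
  refine ⟨_, hlip, ?_, fun t ht => ?_⟩
  · filter_upwards [hlip.ae_differentiableAt_real, hcount.ae_notMem volume] with t hd hn ht
    exact deriv_infDist_mem_of_notMem hS ⟨_, hmem 0⟩ (fun h => hn ⟨h, ht⟩) hd
  · let n := ⌊t ^ 2 / c ^ 2⌋₊
    have hn1 : (n : ℝ) * c ^ 2 ≤ t ^ 2 :=
      (le_div_iff₀ (by positivity)).1 (Nat.floor_le (by positivity))
    have hn2 : t ^ 2 < (n + 1) * c ^ 2 :=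
      (div_lt_iff₀ (by positivity)).1 (Nat.lt_floor_add_one _)
    have hs0 : 0 ≤ c * √n := by positivity
    have hs2 : (c * √n) ^ 2 = n * c ^ 2 := by
      rw [mul_pow, Real.sq_sqrt n.cast_nonneg]; ring
    have hst : c * √n ≤ t := abs_le_of_sq_le_sq' (by linarith) ht |>.2
    have hle : Metric.infDist t S ≤ t - c * √n := by
      simpa [Real.dist_eq, abs_of_nonneg (sub_nonneg.2 hst)]
        using Metric.infDist_le_dist_of_mem (x := t) (hmem n)
    have hc' : t - c * √n ≤ c := abs_le_of_sq_le_sq' (by nlinarith) hc.le |>.2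
    refine ⟨Metric.infDist_nonneg, hle.trans hc', hle.trans ?_⟩
    rw [le_div_iff₀ (by positivity)]
    nlinarith

/-- For every `ε > 0` there exist an initial condition `η = (η₁,η₂,η₃)` of Euclidean
norm `≤ ε` and a solution of `ẋ₁ = x₂²`, `ẋ₂ = x₃²`, `ẋ₃ ∈ {-1,1}` starting at `η`
whose Euclidean norm stays `≤ ε` for all `t ≥ 0`. -/
theorem exists_bounded_solution_near_origin :
    ∀ ε : ℝ, 0 < ε →
      ∃ (η₁ η₂ η₃ : ℝ) (x₁ x₂ x₃ v : ℝ → ℝ),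
        Real.sqrt (η₁ ^ 2 + η₂ ^ 2 + η₃ ^ 2) ≤ ε ∧
        IsSol3 x₁ x₂ x₃ v ∧
        x₁ 0 = η₁ ∧ x₂ 0 = η₂ ∧ x₃ 0 = η₃ ∧
        ∀ t : ℝ, 0 ≤ t →
          Real.sqrt ((x₁ t) ^ 2 + (x₂ t) ^ 2 + (x₃ t) ^ 2) ≤ ε := by
  intro ε hε
  obtain ⟨c, hc, hcε, hc2⟩ : ∃ c : ℝ, 0 < c ∧ c ≤ ε / 2 ∧ c ≤ 1 / 2 :=
    ⟨min (ε / 2) (1 / 2), by positivity, min_le_left _ _, min_le_right _ _⟩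
  obtain ⟨x₃, hlip, hv, hx₃⟩ := exists_zigzag hc
  obtain ⟨x₂, hx₂c, hx₂, hx₂b⟩ := exists_antideriv_of_le_div_sq (g := fun t => x₃ t ^ 2)
    (A := (2 * c ^ 2) ^ 2) (by positivity) hc (hlip.continuous.pow 2) (fun t => sq_nonneg _)
    fun t ht => by
      rw [← div_pow]
      exact pow_le_pow_left₀ (hx₃ t ht).1 (hx₃ t ht).2.2 2
  obtain ⟨x₁, -, hx₁, hx₁b⟩ := exists_antideriv_of_le_div_sq (g := fun t => x₂ t ^ 2)
    (A := ((2 * c ^ 2) ^ 2) ^ 2) (by positivity) hc (hx₂c.pow 2) (fun t => sq_nonneg _)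
    fun t ht => by
      rw [← div_pow, ← sq_abs]
      exact pow_le_pow_left₀ (abs_nonneg _) (hx₂b t ht) 2
  have hac (t : ℝ) : AbsolutelyContinuousOnInterval x₃ 0 t :=
    (hlip.lipschitzOnWith (s := uIcc 0 t)).absolutelyContinuousOnInterval
  have hcc : c ^ 2 ≤ 1 / 4 := by nlinarith
  have hbound : ∀ t : ℝ, 0 ≤ t → √((x₁ t) ^ 2 + (x₂ t) ^ 2 + (x₃ t) ^ 2) ≤ ε := fun t ht => by
    have h3 : x₃ t ^ 2 ≤ c ^ 2 := pow_le_pow_left₀ (hx₃ t ht).1 (hx₃ t ht).2.1 2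
    have h2 : x₂ t ^ 2 ≤ c ^ 2 := by
      have h : |x₂ t| ≤ c := (hx₂b t ht).trans <| by
        rw [div_le_iff₀ (by positivity)]
        nlinarith [mul_nonneg hc.le ht, mul_le_mul_of_nonneg_left hcc (sq_nonneg c)]
      exact sq_le_sq' (abs_le.1 h).1 (abs_le.1 h).2
    have h1 : x₁ t ^ 2 ≤ c ^ 2 := by
      have h : |x₁ t| ≤ c := (hx₁b t ht).trans <| by
        rw [div_le_iff₀ (by positivity)]
        have h4 : (2 * c ^ 2) ^ 2 ≤ c ^ 2 := by
          nlinarith [mul_le_mul_of_nonneg_left hcc (sq_nonneg c)]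
        nlinarith [mul_nonneg hc.le ht, pow_le_pow_left₀ (by positivity) h4 2,
          mul_le_mul_of_nonneg_left hcc (sq_nonneg c)]
      exact sq_le_sq' (abs_le.1 h).1 (abs_le.1 h).2
    rw [Real.sqrt_le_left hε.le]
    nlinarith
  refine ⟨x₁ 0, x₂ 0, x₃ 0, x₁, x₂, x₃, deriv x₃, hbound 0 le_rfl,
    ⟨fun t ht => ?_, hv, fun t _ => ?_, fun t _ => hx₂ t, fun t _ => hx₁ t⟩, rfl, rfl, rfl, hbound⟩
  · exact (intervalIntegrable_iff_integrableOn_Icc_of_le ht).1 (hac t).intervalIntegrable_deriv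
  · rw [(hac t).integral_deriv_eq_sub]; ring
end
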